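/- For each S_μ-invariant polynomial γ ∈ ℂ[X_μ]^{S_μ} let c_γ be the K-linear operator on V_K determined by c_γ T(z) = γ(x+z) T(z). Then each c_γ preserves L_η and therefore induces a ℂ-linear operator on V(T(v)) = ℂ_v ⊗_{B_η} L_η. The set {𝒟_σ^η(v+z) : z ∈ N_η, σ ∈ Shuffle^η_{ε(z)}} is a ℂ-basis of V(T(v)); for z ∈ N_η let V_z be the ℂ-span of {𝒟_σ^η(v+z) : σ ∈ Shuffle^η_{ε(z)}}. Then: (i) for every γ ∈ ℂ[X_μ]^{S_μ}, every z ∈ N_η and every σ ∈ Shuffle^η_{ε(z)}, (c_γ − γ(v+z))^{ℓ(σ)+1} 𝒟_σ^η(v+z) = 0; (ii) V(T(v)) = ⊕_{z∈N_η} V_z, and V_z is exactly the joint generalized eigenspace of the commuting family {c_γ : γ ∈ ℂ[X_μ]^{S_μ}} with eigenvalue character γ ↦ γ(v+z); (iii) dim_ℂ V_z = η!/ε(z)!. In particular V(T(v)) is a Gelfand–Tsetlin module whose support is {χ_{v+z} : z ∈ N_η}, where χ_{v+z}(γ) = γ(v+z), and the multiplicity of χ_{v+z} is η!/ε(z)!.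 -/

import Mathlib

open scoped BigOperators

set_option maxHeartbeats 1000000
set_option synthInstance.maxHeartbeats 400000
noncomputable section

namespace GTpaper

variable (r : ℕ) (η : Fin r → ℕ)

/-- The index set Σ(η): pairs (k,i) with 1 ≤ k ≤ r, 1 ≤ i ≤ η_k (0-based). -/
abbrev Idx := (k : Fin r) × Fin (η k)

/-- The polynomial ring ℂ[X_η]. -/
abbrev Pol := MvPolynomial (Idx r η) ℂ

/-- The field of rational functions F = ℂ(X_η). -/
abbrev FF := FractionRing (Pol r η)

/-- The group S_η = S_{η_1} × ⋯ × S_{η_r}. -/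
abbrev Sg := ∀ k : Fin r, Equiv.Perm (Fin (η k))

/-- The action of S_η on the index set. -/
def permIdx (σ : Sg r η) : Equiv.Perm (Idx r η) where
  toFun p := ⟨p.1, σ p.1 p.2⟩
  invFun p := ⟨p.1, (σ p.1)⁻¹ p.2⟩
  left_inv p := by simp
  right_inv p := by simp

/-- The action of S_η on ℂ[X_η] by permuting variables. -/
def actP (σ : Sg r η) : Pol r η ≃+* Pol r η :=
  (MvPolynomial.renameEquiv ℂ (permIdx r η σ)).toRingEquiv

/-- The action of S_η on F = ℂ(X_η) by field automorphisms. -/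
def actF (σ : Sg r η) : FF r η ≃+* FF r η :=
  IsFractionRing.ringEquivOfRingEquiv (actP r η σ)

/-- The variable x_{k,i} viewed as an element of F. -/
def XF (p : Idx r η) : FF r η := algebraMap (Pol r η) (FF r η) (MvPolynomial.X p)

/-- The element of S_η which transposes (k,i) and (k,j) and fixes all other indices. -/
def transpT (k : Fin r) (i j : Fin (η k)) : Sg r η :=
  Function.update (1 : Sg r η) k (Equiv.swap i j)

/-- The simple transposition s_i^{(k)}. -/
def simpleT (k : Fin r) (i : ℕ) (h : i + 1 < η k) : Sg r η :=
  transpT r η k ⟨i, Nat.lt_of_succ_lt h⟩ ⟨i + 1, h⟩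

/-- The divided difference operator ∂_i^{(k)} on F. -/
def dd (k : Fin r) (i : ℕ) (h : i + 1 < η k) (f : FF r η) : FF r η :=
  (f - actF r η (simpleT r η k i h) f) /
    (XF r η ⟨k, ⟨i, Nat.lt_of_succ_lt h⟩⟩ - XF r η ⟨k, ⟨i + 1, h⟩⟩)

/-- Data indexing a simple transposition of S_η. -/
abbrev SimpleDat := (k : Fin r) × {i : ℕ // i + 1 < η k}

/-- A word in the simple transpositions of S_η. -/
abbrev Word := List (SimpleDat r η)

/-- The element of S_η represented by a word. -/
def wordPerm (w : Word r η) : Sg r η :=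
  (w.map fun s => simpleT r η s.1 s.2.1 s.2.2).prod

/-- The composite ∂_{j_1} ∘ ⋯ ∘ ∂_{j_l} of divided differences along a word. -/
def ddWord (w : Word r η) (f : FF r η) : FF r η :=
  w.foldr (fun s g => dd r η s.1 s.2.1 s.2.2 g) f

/-- The length ℓ(σ): the total number of inversions of σ. -/
def len (σ : Sg r η) : ℕ :=
  ∑ k : Fin r,
    (Finset.univ.filter fun p : Fin (η k) × Fin (η k) => p.1 < p.2 ∧ σ k p.2 < σ k p.1).card

/-- `w` is a reduced decomposition of σ. -/
def IsRed (σ : Sg r η) (w : Word r η) : Prop :=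
  wordPerm r η w = σ ∧ w.length = len r η σ

/-- The longest word w_η of S_η. -/
def wEta : Sg r η := fun _ => Fin.revPerm

/-- η! = η_1! ⋯ η_r!. -/
def etaFact : ℕ := ∏ k : Fin r, Nat.factorial (η k)

/-- The Vandermonde-type product Δ_η as a polynomial. -/
def DeltaP : Pol r η :=
  ∏ k : Fin r, ∏ p ∈ Finset.univ.filter (fun p : Fin (η k) × Fin (η k) => p.1 < p.2),
    (MvPolynomial.X (⟨k, p.1⟩ : Idx r η) - MvPolynomial.X (⟨k, p.2⟩ : Idx r η))

/-- Δ_η as an element of F. -/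
def DeltaF : FF r η := algebraMap (Pol r η) (FF r η) (DeltaP r η)

/-- The symmetrization operator sym_η on F. -/
def symF (f : FF r η) : FF r η :=
  (etaFact r η : FF r η)⁻¹ * ∑ σ : Sg r η, actF r η σ f

/-- The sign of an element of S_η. -/
def sgn (σ : Sg r η) : ℤ := ∏ k : Fin r, (Equiv.Perm.sign (σ k) : ℤ)

/-- The antisymmetrization operator asym_η on F. -/
def asymF (f : FF r η) : FF r η :=
  (etaFact r η : FF r η)⁻¹ * ∑ σ : Sg r η, (sgn r η σ : FF r η) * actF r η σ f

/-- The ideal p_η of ℂ[X_η] generated by the differences x_{k,i} - x_{k,j}. -/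
def pIdeal : Ideal (Pol r η) :=
  Ideal.span {q | ∃ (k : Fin r) (i j : Fin (η k)), i < j ∧
    q = MvPolynomial.X (⟨k, i⟩ : Idx r η) - MvPolynomial.X (⟨k, j⟩ : Idx r η)}

/-! ### The Gelfand–Tsetlin setting: μ = (1,2,…,n) -/

/-- The composition μ = (1,2,…,n) (0-based: row k has k+1 entries). -/
abbrev mEta (n : ℕ) : Fin n → ℕ := fun k => (k : ℕ) + 1

/-- The index set of Gelfand–Tsetlin tableaux entries. -/
abbrev IdxN (n : ℕ) := Idx n (mEta n)

/-- The polynomial ring ℂ[X_μ]. -/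
abbrev PolN (n : ℕ) := Pol n (mEta n)

/-- The field K = ℂ(X_μ). -/
abbrev KK (n : ℕ) := FF n (mEta n)

/-- The group S_μ = S_1 × S_2 × ⋯ × S_n. -/
abbrev SgN (n : ℕ) := Sg n (mEta n)

variable (n : ℕ)

/-- The additive group ℤ^μ_0 of integral μ-points with vanishing top row. -/
def Z0sub : AddSubgroup (IdxN n → ℤ) where
  carrier := {z | ∀ p : IdxN n, (p.1 : ℕ) + 1 = n → z p = 0}
  add_mem' := by intro a b ha hb p hp; simp [ha p hp, hb p hp]
  zero_mem' := by intro p _; rfl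
  neg_mem' := by intro a ha p hp; simp [ha p hp]

abbrev Z0 := ↥(Z0sub n)

/-- The K-vector space V_K with basis {T(z) : z ∈ ℤ^μ_0}. -/
def VK : Type := Z0 n →₀ KK n

instance : AddCommGroup (VK n) := inferInstanceAs (AddCommGroup (Z0 n →₀ KK n))
instance : Module (KK n) (VK n) := inferInstanceAs (Module (KK n) (Z0 n →₀ KK n))
instance : Module ℂ (VK n) := inferInstanceAs (Module ℂ (Z0 n →₀ KK n))
instance : IsScalarTower ℂ (KK n) (VK n) :=
  inferInstanceAs (IsScalarTower ℂ (KK n) (Z0 n →₀ KK n))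
instance : SMulCommClass (KK n) (KK n) (VK n) :=
  inferInstanceAs (SMulCommClass (KK n) (KK n) (Z0 n →₀ KK n))

/-- The tableau T(z), as a basis vector of V_K. -/
def T (z : Z0 n) : VK n := Finsupp.single z 1

/-- The translation automorphism f(x) ↦ f(x+z) of ℂ[X_μ]. -/
def shiftP (z : IdxN n → ℤ) : PolN n ≃ₐ[ℂ] PolN n :=
  AlgEquiv.ofAlgHom
    (MvPolynomial.aeval fun p => MvPolynomial.X p + MvPolynomial.C ((z p : ℤ) : ℂ))
    (MvPolynomial.aeval fun p => MvPolynomial.X p - MvPolynomial.C ((z p : ℤ) : ℂ))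
    (by apply MvPolynomial.algHom_ext; intro p; simp)
    (by apply MvPolynomial.algHom_ext; intro p; simp)

/-- The translation automorphism f(x) ↦ f(x+z) of K = ℂ(X_μ). -/
def shiftK (z : IdxN n → ℤ) : KK n ≃+* KK n :=
  IsFractionRing.ringEquivOfRingEquiv (shiftP n z).toRingEquiv

/-- The tuple δ^{k,i} ∈ ℤ^μ_0. -/
def deltaZ (k : ℕ) (hk : k + 1 < n) (i : Fin (k + 1)) : Z0 n :=
  ⟨Pi.single (⟨⟨k, Nat.lt_of_succ_lt hk⟩, i⟩ : IdxN n) (1 : ℤ), by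
    intro p hp
    rw [Pi.single_apply]
    have : p ≠ (⟨⟨k, Nat.lt_of_succ_lt hk⟩, i⟩ : IdxN n) := by
      intro h; rw [h] at hp; simp at hp; omega
    simp [this]⟩

/-- The Gelfand–Tsetlin function e⁺_{k,i} ∈ K (0-based row k, 0 ≤ k ≤ n-2). -/
def ePlus (k : ℕ) (hk : k + 1 < n) (i : Fin (k + 1)) : KK n :=
  (∏ j : Fin (k + 2),
      (XF n (mEta n) ⟨⟨k, Nat.lt_of_succ_lt hk⟩, i⟩ - XF n (mEta n) ⟨⟨k + 1, hk⟩, j⟩)) /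
  (∏ j ∈ Finset.univ.erase i,
      (XF n (mEta n) ⟨⟨k, Nat.lt_of_succ_lt hk⟩, i⟩ -
        XF n (mEta n) ⟨⟨k, Nat.lt_of_succ_lt hk⟩, j⟩))

/-- The Gelfand–Tsetlin function e⁻_{k,i} ∈ K (0-based row k, 0 ≤ k ≤ n-2). -/
def eMinus (k : ℕ) (hk : k + 1 < n) (i : Fin (k + 1)) : KK n :=
  (∏ j : Fin k,
      (XF n (mEta n) ⟨⟨k, Nat.lt_of_succ_lt hk⟩, i⟩ -
        XF n (mEta n) ⟨⟨k - 1, by omega⟩, Fin.castLE (by simp only [mEta]; omega) j⟩)) /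
  (∏ j ∈ Finset.univ.erase i,
      (XF n (mEta n) ⟨⟨k, Nat.lt_of_succ_lt hk⟩, i⟩ -
        XF n (mEta n) ⟨⟨k, Nat.lt_of_succ_lt hk⟩, j⟩))

/-- The Gelfand–Tsetlin operator E_{k,k+1} (0-based: matrix unit (k, k+1)). -/
def Eop (k : ℕ) (hk : k + 1 < n) : Module.End (KK n) (VK n) :=
  Finsupp.lsum (KK n) fun z => LinearMap.toSpanSingleton (KK n) (VK n)
    (-∑ i : Fin (k + 1),
      shiftK n (z : IdxN n → ℤ) (ePlus n k hk i) • T n (z + deltaZ n k hk i))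

/-- The Gelfand–Tsetlin operator E_{k+1,k} (0-based: matrix unit (k+1, k)). -/
def Fop (k : ℕ) (hk : k + 1 < n) : Module.End (KK n) (VK n) :=
  Finsupp.lsum (KK n) fun z => LinearMap.toSpanSingleton (KK n) (VK n)
    (∑ i : Fin (k + 1),
      shiftK n (z : IdxN n → ℤ) (eMinus n k hk i) • T n (z - deltaZ n k hk i))

/-- The Gelfand–Tsetlin operator E_{k,k} (0-based row k of the diagonal). -/
def Hop (k : Fin n) : Module.End (KK n) (VK n) :=
  Finsupp.lsum (KK n) fun z => LinearMap.toSpanSingleton (KK n) (VK n)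
    (((∑ j : Fin ((k : ℕ) + 1),
        (XF n (mEta n) ⟨k, j⟩ + ((z : IdxN n → ℤ) ⟨k, j⟩ : KK n))) -
      (∑ j : Fin (k : ℕ),
        (XF n (mEta n) ⟨⟨(k : ℕ) - 1, by omega⟩, Fin.castLE (by simp only [mEta]; omega) j⟩ +
          ((z : IdxN n → ℤ) ⟨⟨(k : ℕ) - 1, by omega⟩, Fin.castLE (by simp only [mEta]; omega) j⟩ : KK n))) +
      ((k : ℕ) : KK n)) • T n z)

/-- The action of S_μ on ℤ^μ_0. -/
def permZ0 (σ : SgN n) : Z0 n ≃ Z0 n where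
  toFun z := ⟨fun p => (z : IdxN n → ℤ) ((permIdx n (mEta n) σ).symm p), by
    intro p hp
    exact z.2 ((permIdx n (mEta n) σ).symm p) hp⟩
  invFun z := ⟨fun p => (z : IdxN n → ℤ) (permIdx n (mEta n) σ p), by
    intro p hp
    exact z.2 (permIdx n (mEta n) σ p) hp⟩
  left_inv z := by ext p; simp
  right_inv z := by ext p; simp

/-- The diagonal action of S_μ on V_K : σ·(f T(z)) = σ(f) T(σ(z)). -/
def sact (σ : SgN n) (w : VK n) : VK n :=
  Finsupp.equivMapDomain (permZ0 n σ) (Finsupp.mapRange (actF n (mEta n) σ) (map_zero _) w)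
/-! ### Refinements η of μ, given by a block function on the index set -/

variable (blk : IdxN n → ℕ)

/-- The subgroup S_η ⊆ S_μ of permutations preserving each η-block. -/
def SgEta : Subgroup (SgN n) where
  carrier := {σ | ∀ p : IdxN n, blk (permIdx n (mEta n) σ p) = blk p}
  one_mem' := fun _ => rfl
  mul_mem' := by
    intro a b ha hb p
    exact (ha (permIdx n (mEta n) b p)).trans (hb p)
  inv_mem' := by
    intro a ha p
    have h := ha (permIdx n (mEta n) a⁻¹ p)
    simpa [permIdx] using h.symm

/-- η! : the order of S_η (the product of the factorials of the parts of η). -/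
def etaFactB : ℕ := Nat.card ↥(SgEta n blk)

/-- The symmetrization operator sym_η on K. -/
noncomputable def symK (f : KK n) : KK n :=
  haveI : Fintype ↥(SgEta n blk) := Fintype.ofFinite _
  (etaFactB n blk : KK n)⁻¹ * ∑ τ : ↥(SgEta n blk), actF n (mEta n) (τ : SgN n) f

/-- The symmetrization operator sym_η on V_K (for the diagonal action). -/
noncomputable def symV (x : VK n) : VK n :=
  haveI : Fintype ↥(SgEta n blk) := Fintype.ofFinite _
  (etaFactB n blk : KK n)⁻¹ • ∑ τ : ↥(SgEta n blk), sact n (τ : SgN n) x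

/-- The divided difference operator ∂_i^{(k)} acting on V_K via the diagonal action. -/
noncomputable def ddV (k : Fin n) (i : ℕ) (h : i + 1 < mEta n k) (x : VK n) : VK n :=
  (XF n (mEta n) ⟨k, ⟨i, Nat.lt_of_succ_lt h⟩⟩ - XF n (mEta n) ⟨k, ⟨i + 1, h⟩⟩)⁻¹ •
    (x - sact n (simpleT n (mEta n) k i h) x)

/-- The composite of divided differences on V_K along a word. -/
noncomputable def ddWordV (w : Word n (mEta n)) (x : VK n) : VK n :=
  w.foldr (fun s g => ddV n s.1 s.2.1 s.2.2 g) x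

/-- All letters of the word are simple transpositions inside η-blocks (i.e. lie in S_η). -/
def WordBlk (w : Word n (mEta n)) : Prop :=
  ∀ s ∈ w, blk ⟨s.1, ⟨s.2.1, Nat.lt_of_succ_lt s.2.2⟩⟩ = blk ⟨s.1, ⟨s.2.1 + 1, s.2.2⟩⟩

/-- `w` is a reduced decomposition of σ into simple transpositions of S_η. -/
def IsRedB (σ : SgN n) (w : Word n (mEta n)) : Prop :=
  IsRed n (mEta n) σ w ∧ WordBlk n blk w

/-- The multiplicative set of ℂ[X_μ] generated by the x_{k,i} − x_{k,j} − c (c a nonzero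
integer, row k below the top) and by the x_{k,i} − x_{k,j} with (k,i), (k,j) in different
η-blocks. -/
def BMon : Submonoid (PolN n) :=
  Submonoid.closure
    ({q | ∃ (k : Fin n) (i j : Fin ((k : ℕ) + 1)) (c : ℤ), (k : ℕ) + 1 < n ∧ i < j ∧ c ≠ 0 ∧
        q = MvPolynomial.X (⟨k, i⟩ : IdxN n) - MvPolynomial.X (⟨k, j⟩ : IdxN n) -
          MvPolynomial.C (c : ℂ)} ∪
     {q | ∃ (k : Fin n) (i j : Fin ((k : ℕ) + 1)), blk ⟨k, i⟩ ≠ blk ⟨k, j⟩ ∧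
        q = MvPolynomial.X (⟨k, i⟩ : IdxN n) - MvPolynomial.X (⟨k, j⟩ : IdxN n)})

/-- The algebra B_η ⊆ K : the localization of ℂ[X_μ] at the multiplicative set `BMon`,
viewed as the subalgebra of K of fractions with denominator in `BMon`. -/
def Balg : Subalgebra ℂ (KK n) where
  carrier := {f | ∃ p : PolN n, ∃ q ∈ BMon n blk,
    f * algebraMap (PolN n) (KK n) q = algebraMap (PolN n) (KK n) p}
  mul_mem' := by
    rintro f g ⟨p₁, q₁, hq₁, h₁⟩ ⟨p₂, q₂, hq₂, h₂⟩
    refine ⟨p₁ * p₂, q₁ * q₂, mul_mem hq₁ hq₂, ?_⟩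
    have : f * g * algebraMap (PolN n) (KK n) (q₁ * q₂) =
        (f * algebraMap (PolN n) (KK n) q₁) * (g * algebraMap (PolN n) (KK n) q₂) := by
      rw [map_mul]; ring
    rw [this, h₁, h₂, ← map_mul]
  one_mem' := ⟨1, 1, one_mem _, by simp⟩
  add_mem' := by
    rintro f g ⟨p₁, q₁, hq₁, h₁⟩ ⟨p₂, q₂, hq₂, h₂⟩
    refine ⟨p₁ * q₂ + p₂ * q₁, q₁ * q₂, mul_mem hq₁ hq₂, ?_⟩
    have : (f + g) * algebraMap (PolN n) (KK n) (q₁ * q₂) =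
        (f * algebraMap (PolN n) (KK n) q₁) * algebraMap (PolN n) (KK n) q₂ +
        (g * algebraMap (PolN n) (KK n) q₂) * algebraMap (PolN n) (KK n) q₁ := by
      rw [map_mul]; ring
    rw [this, h₁, h₂, ← map_mul, ← map_mul, ← map_add]
  zero_mem' := ⟨0, 1, one_mem _, by simp⟩
  algebraMap_mem' := by
    intro c
    refine ⟨MvPolynomial.C c, 1, one_mem _, ?_⟩
    rw [map_one, mul_one, IsScalarTower.algebraMap_apply ℂ (PolN n) (KK n)]
    simp [MvPolynomial.algebraMap_eq]

/-- The set N_η of integral points which are weakly decreasing along each η-block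
(normal-form representatives of the S_η-orbits). -/
def Nset : Set (Z0 n) :=
  {z | ∀ (k : Fin n) (i j : Fin ((k : ℕ) + 1)), i ≤ j → blk ⟨k, i⟩ = blk ⟨k, j⟩ →
    (z : IdxN n → ℤ) ⟨k, j⟩ ≤ (z : IdxN n → ℤ) ⟨k, i⟩}

/-- σ is an ε(z)-shuffle: σ ∈ S_η and σ is increasing on each ε(z)-block, where ε(z) is
the refinement of η whose blocks are the runs of equal entries of z inside the η-blocks
(so S_{ε(z)} is the stabilizer of z in S_η). -/
def IsShuffle (z : Z0 n) (σ : SgN n) : Prop :=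
  σ ∈ SgEta n blk ∧
    ∀ (k : Fin n) (i j : Fin ((k : ℕ) + 1)), i < j → blk ⟨k, i⟩ = blk ⟨k, j⟩ →
      (z : IdxN n → ℤ) ⟨k, i⟩ = (z : IdxN n → ℤ) ⟨k, j⟩ → σ k i < σ k j

/-- The index set for the basis of derived tableaux. -/
def BIdx : Type :=
  {x : Z0 n × SgN n // x.1 ∈ Nset n blk ∧ IsShuffle n blk x.1 x.2}

/-- The operator c_γ on V_K, given by c_γ T(z) = γ(x+z) T(z). -/
noncomputable def copN (γ : PolN n) : Module.End (KK n) (VK n) :=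
  Finsupp.lsum (KK n) fun z => LinearMap.toSpanSingleton (KK n) (VK n)
    (shiftK n (z : IdxN n → ℤ) (algebraMap (PolN n) (KK n) γ) • T n z)

/-- Evaluation γ(v+z) of a polynomial at the point v + z. -/
noncomputable def evalVZ (v : IdxN n → ℂ) (z : Z0 n) (γ : PolN n) : ℂ :=
  MvPolynomial.eval (fun p => v p + ((z : IdxN n → ℤ) p : ℂ)) γ

section DerivedTableaux

variable {n : ℕ} {blk : IdxN n → ℕ}

/-! ### Lengths of permutations -/

/-- The inversions of a permutation of `Fin m`. -/
def invs {m : ℕ} (σ : Equiv.Perm (Fin m)) : Finset (Fin m × Fin m) :=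
  Finset.univ.filter fun p => p.1 < p.2 ∧ σ p.2 < σ p.1

theorem mem_invs {m : ℕ} {σ : Equiv.Perm (Fin m)} {p : Fin m × Fin m} :
    p ∈ invs σ ↔ p.1 < p.2 ∧ σ p.2 < σ p.1 := by simp [invs]

/-- The simple transposition of `Fin m` exchanging `i` and `i + 1`. -/
def adjSwap {m : ℕ} (i : ℕ) (h : i + 1 < m) : Equiv.Perm (Fin m) :=
  Equiv.swap ⟨i, Nat.lt_of_succ_lt h⟩ ⟨i + 1, h⟩

theorem adjSwap_adjSwap {m : ℕ} (i : ℕ) (h : i + 1 < m) (a : Fin m) :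
    adjSwap i h (adjSwap i h a) = a := by simp [adjSwap]

theorem adjSwap_lt {m : ℕ} (i : ℕ) (h : i + 1 < m) {a b : Fin m} (hab : a < b)
    (hne : ¬ ((a : ℕ) = i ∧ (b : ℕ) = i + 1)) : adjSwap i h a < adjSwap i h b := by
  simp only [adjSwap, Equiv.swap_apply_def, Fin.ext_iff]
  rw [Fin.lt_def] at *
  split_ifs <;> simp_all <;> omega

theorem card_invs_mul_adjSwap {m : ℕ} (σ : Equiv.Perm (Fin m)) (i : ℕ) (h : i + 1 < m)
    (hlt : σ ⟨i + 1, h⟩ < σ ⟨i, Nat.lt_of_succ_lt h⟩) :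
    (invs (σ * adjSwap i h)).card + 1 = (invs σ).card := by
  have hmem : ((⟨i, Nat.lt_of_succ_lt h⟩, ⟨i + 1, h⟩) : Fin m × Fin m) ∈ invs σ := by
    rw [mem_invs]; exact ⟨by simp, hlt⟩
  have hs1 : adjSwap i h ⟨i, Nat.lt_of_succ_lt h⟩ = ⟨i + 1, h⟩ := by simp [adjSwap]
  have hs2 : adjSwap i h ⟨i + 1, h⟩ = ⟨i, Nat.lt_of_succ_lt h⟩ := by simp [adjSwap]
  rw [← Finset.card_erase_add_one hmem]
  congr 1
  have hne : ∀ a b : Fin m, (a, b) ∈ invs (σ * adjSwap i h) →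
      ¬ ((a : ℕ) = i ∧ (b : ℕ) = i + 1) := by
    rintro a b hab ⟨ha, hb⟩
    obtain rfl : a = ⟨i, Nat.lt_of_succ_lt h⟩ := Fin.ext ha
    obtain rfl : b = ⟨i + 1, h⟩ := Fin.ext hb
    have := (mem_invs.1 hab).2
    simp only [Equiv.Perm.mul_apply, hs1, hs2] at this
    exact absurd this (not_lt.2 hlt.le)
  refine Finset.card_nbij' (fun p => (adjSwap i h p.1, adjSwap i h p.2))
    (fun p => (adjSwap i h p.1, adjSwap i h p.2)) ?_ ?_ ?_ ?_
  · rintro ⟨a, b⟩ hab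
    have hn := hne a b hab
    have hab' := mem_invs.1 hab
    refine Finset.mem_coe.2 (Finset.mem_erase.2 ⟨?_, mem_invs.2 ⟨adjSwap_lt i h hab'.1 hn, hab'.2⟩⟩)
    intro he
    rw [Prod.mk.injEq] at he
    have h1 : a = ⟨i + 1, h⟩ := by rw [← adjSwap_adjSwap i h a, he.1, hs1]
    have h2 : b = ⟨i, Nat.lt_of_succ_lt h⟩ := by rw [← adjSwap_adjSwap i h b, he.2, hs2]
    have := hab'.1
    rw [h1, h2] at this
    simp [Fin.lt_def] at this
  · rintro ⟨a, b⟩ hab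
    obtain ⟨hn, hab⟩ := Finset.mem_erase.1 (Finset.mem_coe.1 hab)
    have hab' := mem_invs.1 hab
    refine Finset.mem_coe.2 (mem_invs.2 ⟨adjSwap_lt i h hab'.1 ?_, ?_⟩)
    · rintro ⟨ha, hb⟩
      exact hn (Prod.ext (Fin.ext ha) (Fin.ext hb))
    · simpa [Equiv.Perm.mul_apply, adjSwap_adjSwap] using hab'.2
  · rintro ⟨a, b⟩ _; simp [adjSwap_adjSwap]
  · rintro ⟨a, b⟩ _; simp [adjSwap_adjSwap]

theorem card_invs_inv {m : ℕ} (σ : Equiv.Perm (Fin m)) : (invs σ⁻¹).card = (invs σ).card := by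
  refine Finset.card_nbij' (fun p => (σ⁻¹ p.2, σ⁻¹ p.1)) (fun p => (σ p.2, σ p.1)) ?_ ?_ ?_ ?_
  · rintro ⟨a, b⟩ hab
    have := mem_invs.1 hab
    exact Finset.mem_coe.2 (mem_invs.2 ⟨this.2, by simpa using this.1⟩)
  · rintro ⟨a, b⟩ hab
    have := mem_invs.1 hab
    exact Finset.mem_coe.2 (mem_invs.2 ⟨this.2, by simpa using this.1⟩)
  · rintro ⟨a, b⟩ _; simp
  · rintro ⟨a, b⟩ _; simp

theorem perm_eq_one_of_strictMono {m : ℕ} {σ : Equiv.Perm (Fin m)} (hσ : StrictMono σ) :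
    σ = 1 := by
  ext i
  have : (hσ.orderIsoOfSurjective _ σ.surjective) = OrderIso.refl _ := Subsingleton.elim _ _
  have := congrArg (fun f => f i) this
  simpa [Fin.ext_iff] using this

/-- A non-identity permutation has a descent. -/
theorem exists_descent {m : ℕ} {σ : Equiv.Perm (Fin m)} (hσ : σ ≠ 1) :
    ∃ (i : ℕ) (h : i + 1 < m), σ ⟨i + 1, h⟩ < σ ⟨i, Nat.lt_of_succ_lt h⟩ := by
  by_contra! hc
  refine hσ (perm_eq_one_of_strictMono ?_)
  rcases m with _ | m
  · intro a; exact a.elim0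
  · rw [Fin.strictMono_iff_lt_succ]
    intro i
    refine lt_of_le_of_ne (hc i (by omega)) fun he => ?_
    have := σ.injective he
    simp [Fin.ext_iff] at this

theorem len_eq (σ : SgN n) : len n (mEta n) σ = ∑ k : Fin n, (invs (σ k)).card := rfl

theorem simpleT_same (k : Fin n) (i : ℕ) (h : i + 1 < mEta n k) :
    simpleT n (mEta n) k i h k = adjSwap i h := by
  simp [simpleT, transpT, adjSwap]

theorem simpleT_ne (k : Fin n) (i : ℕ) (h : i + 1 < mEta n k) {l : Fin n} (hl : l ≠ k) :
    simpleT n (mEta n) k i h l = 1 := by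
  simp [simpleT, transpT, hl]

theorem simpleT_mul_self (k : Fin n) (i : ℕ) (h : i + 1 < mEta n k) :
    simpleT n (mEta n) k i h * simpleT n (mEta n) k i h = 1 := by
  funext l
  by_cases hl : l = k
  · subst hl
    ext a
    simp [simpleT_same, adjSwap_adjSwap]
  · simp [simpleT_ne k i h hl]

theorem simpleT_inv (k : Fin n) (i : ℕ) (h : i + 1 < mEta n k) :
    (simpleT n (mEta n) k i h)⁻¹ = simpleT n (mEta n) k i h :=
  inv_eq_of_mul_eq_one_left (simpleT_mul_self k i h)

theorem len_mul_simpleT_of_gt (σ : SgN n) (k : Fin n) (i : ℕ) (h : i + 1 < mEta n k)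
    (hlt : σ k ⟨i + 1, h⟩ < σ k ⟨i, Nat.lt_of_succ_lt h⟩) :
    len n (mEta n) (σ * simpleT n (mEta n) k i h) + 1 = len n (mEta n) σ := by
  rw [len_eq, len_eq, ← Finset.add_sum_erase _ _ (Finset.mem_univ k),
    ← Finset.add_sum_erase Finset.univ (fun k => (invs (σ k)).card) (Finset.mem_univ k),
    Finset.sum_congr rfl (g := fun k => (invs (σ k)).card)]
  · simp only [Pi.mul_apply]
    rw [simpleT_same, ← card_invs_mul_adjSwap (σ k) i h hlt]
    omega
  · intro l hl
    rw [Pi.mul_apply, simpleT_ne k i h (Finset.ne_of_mem_erase hl), mul_one]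

theorem len_mul_simpleT_of_lt (σ : SgN n) (k : Fin n) (i : ℕ) (h : i + 1 < mEta n k)
    (hlt : σ k ⟨i, Nat.lt_of_succ_lt h⟩ < σ k ⟨i + 1, h⟩) :
    len n (mEta n) (σ * simpleT n (mEta n) k i h) = len n (mEta n) σ + 1 := by
  rw [← len_mul_simpleT_of_gt (σ * simpleT n (mEta n) k i h) k i h, mul_assoc, simpleT_mul_self,
    mul_one]
  simpa [simpleT_same, adjSwap] using hlt

theorem len_inv (σ : SgN n) : len n (mEta n) σ⁻¹ = len n (mEta n) σ := by
  rw [len_eq, len_eq]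
  exact Finset.sum_congr rfl fun k _ => card_invs_inv (σ k)

theorem len_mul_simpleT (σ : SgN n) (k : Fin n) (i : ℕ) (h : i + 1 < mEta n k) :
    len n (mEta n) (σ * simpleT n (mEta n) k i h) = len n (mEta n) σ + 1 ∨
      len n (mEta n) (σ * simpleT n (mEta n) k i h) + 1 = len n (mEta n) σ := by
  rcases lt_trichotomy (σ k ⟨i, Nat.lt_of_succ_lt h⟩) (σ k ⟨i + 1, h⟩) with hlt | he | hgt
  · exact Or.inl (len_mul_simpleT_of_lt σ k i h hlt)
  · have := (σ k).injective he
    simp [Fin.ext_iff] at this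
  · exact Or.inr (len_mul_simpleT_of_gt σ k i h hgt)

theorem len_simpleT_mul (σ : SgN n) (k : Fin n) (i : ℕ) (h : i + 1 < mEta n k) :
    len n (mEta n) (simpleT n (mEta n) k i h * σ) = len n (mEta n) σ + 1 ∨
      len n (mEta n) (simpleT n (mEta n) k i h * σ) + 1 = len n (mEta n) σ := by
  have := len_mul_simpleT σ⁻¹ k i h
  rwa [← len_inv, mul_inv_rev, inv_inv, simpleT_inv, len_inv] at this

/-- The letter `s` lies inside an η-block. -/
def LetBlk (blk : IdxN n → ℕ) (s : SimpleDat n (mEta n)) : Prop :=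
  blk ⟨s.1, ⟨s.2.1, Nat.lt_of_succ_lt s.2.2⟩⟩ = blk ⟨s.1, ⟨s.2.1 + 1, s.2.2⟩⟩

/-- The element of `S_μ` represented by a letter. -/
abbrev sT (s : SimpleDat n (mEta n)) : SgN n := simpleT n (mEta n) s.1 s.2.1 s.2.2

theorem mem_SgEta {σ : SgN n} :
    σ ∈ SgEta n blk ↔ ∀ (k : Fin n) (i : Fin (mEta n k)), blk ⟨k, σ k i⟩ = blk ⟨k, i⟩ :=
  ⟨fun h k i => h ⟨k, i⟩, fun h p => h p.1 p.2⟩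

theorem sT_mem {s : SimpleDat n (mEta n)} (hs : LetBlk blk s) : sT s ∈ SgEta n blk := by
  obtain ⟨k, i, h⟩ := s
  rw [mem_SgEta]
  intro l a
  by_cases hl : l = k
  · subst hl
    rw [sT, simpleT_same, adjSwap, Equiv.swap_apply_def]
    unfold LetBlk at hs
    split_ifs with h1 h2
    · rw [h1]; exact hs.symm
    · rw [h2]; exact hs
    · rfl
  · rw [sT, simpleT_ne k i h hl]; rfl

theorem wordPerm_cons (s : SimpleDat n (mEta n)) (w : Word n (mEta n)) :
    wordPerm n (mEta n) (s :: w) = sT s * wordPerm n (mEta n) w := rfl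

theorem wordPerm_append (w w' : Word n (mEta n)) :
    wordPerm n (mEta n) (w ++ w') = wordPerm n (mEta n) w * wordPerm n (mEta n) w' := by
  simp [wordPerm]

theorem len_one : len n (mEta n) 1 = 0 := by
  rw [len_eq]
  refine Finset.sum_eq_zero fun k _ => Finset.card_eq_zero.2 ?_
  refine Finset.eq_empty_of_forall_notMem fun p hp => ?_
  have := mem_invs.1 hp
  exact absurd this.1 (not_lt.2 this.2.le)

theorem lt_of_blk_lt (hmono : ∀ k : Fin n, Monotone fun i : Fin ((k : ℕ) + 1) => blk ⟨k, i⟩)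
    {k : Fin n} {i j : Fin ((k : ℕ) + 1)} (h : blk ⟨k, i⟩ < blk ⟨k, j⟩) : i < j := by
  by_contra hc
  exact absurd (hmono k (not_lt.1 hc)) (not_le.2 h)

/-- Every nontrivial element of `S_η` has a descent inside an η-block. -/
theorem exists_blk_descent
    (hmono : ∀ k : Fin n, Monotone fun i : Fin ((k : ℕ) + 1) => blk ⟨k, i⟩)
    {σ : SgN n} (hσ : σ ∈ SgEta n blk) (h1 : σ ≠ 1) :
    ∃ s : SimpleDat n (mEta n), LetBlk blk s ∧
      σ s.1 ⟨s.2.1 + 1, s.2.2⟩ < σ s.1 ⟨s.2.1, Nat.lt_of_succ_lt s.2.2⟩ := by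
  obtain ⟨k, hk⟩ := Function.ne_iff.1 h1
  obtain ⟨i, h, hlt⟩ := exists_descent hk
  refine ⟨⟨k, i, h⟩, ?_, hlt⟩
  have hle : blk ⟨k, ⟨i, Nat.lt_of_succ_lt h⟩⟩ ≤ blk ⟨k, ⟨i + 1, h⟩⟩ :=
    hmono k (by simp [Fin.le_def])
  refine le_antisymm hle (not_lt.1 fun hl => ?_)
  rw [← mem_SgEta.1 hσ k, ← mem_SgEta.1 hσ k ⟨i + 1, h⟩] at hl
  exact absurd hlt (not_lt.2 (lt_of_blk_lt hmono hl).le)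

theorem exists_isRedB (hmono : ∀ k : Fin n, Monotone fun i : Fin ((k : ℕ) + 1) => blk ⟨k, i⟩)
    {σ : SgN n} (hσ : σ ∈ SgEta n blk) : ∃ w, IsRedB n blk σ w := by
  induction hl : len n (mEta n) σ using Nat.strong_induction_on generalizing σ with
  | _ l ih =>
    by_cases h1 : σ = 1
    · subst h1
      exact ⟨[], ⟨rfl, by simp [len_one]⟩, by simp [WordBlk]⟩
    · obtain ⟨s, hs, hlt⟩ := exists_blk_descent hmono hσ h1
      have hlen : len n (mEta n) (σ * sT s) + 1 = len n (mEta n) σ :=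
        len_mul_simpleT_of_gt σ s.1 s.2.1 s.2.2 hlt
      obtain ⟨w, ⟨hw1, hw2⟩, hw3⟩ := ih _ (by omega) (mul_mem hσ (sT_mem hs)) rfl
      refine ⟨w ++ [s], ⟨?_, ?_⟩, ?_⟩
      · rw [wordPerm_append, hw1, wordPerm_cons, mul_assoc, ← mul_assoc (sT s), simpleT_mul_self]
        simp [wordPerm]
      · rw [List.length_append, hw2, ← hlen]; rfl
      · intro t ht
        rcases List.mem_append.1 ht with ht | ht
        · exact hw3 t ht
        · rw [List.mem_singleton.1 ht]; exact hs

/-! ### The actions of `S_μ` -/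

theorem permIdx_one : permIdx n (mEta n) 1 = 1 := rfl

theorem actP_apply (σ : SgN n) (p : PolN n) :
    actP n (mEta n) σ p = MvPolynomial.rename (permIdx n (mEta n) σ) p := rfl

theorem actP_mul (σ τ : SgN n) (p : PolN n) :
    actP n (mEta n) (σ * τ) p = actP n (mEta n) σ (actP n (mEta n) τ p) := by
  simp only [actP_apply, MvPolynomial.rename_rename]
  rfl

theorem actP_one (p : PolN n) : actP n (mEta n) 1 p = p := by
  simp only [actP_apply, permIdx_one]
  exact MvPolynomial.rename_id_apply p

theorem actF_algebraMap (σ : SgN n) (p : PolN n) :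
    actF n (mEta n) σ (algebraMap (PolN n) (KK n) p) =
      algebraMap (PolN n) (KK n) (actP n (mEta n) σ p) :=
  IsFractionRing.ringEquivOfRingEquiv_algebraMap _ _

theorem actF_mul (σ τ : SgN n) (f : KK n) :
    actF n (mEta n) (σ * τ) f = actF n (mEta n) σ (actF n (mEta n) τ f) := by
  obtain ⟨a, b, -, rfl⟩ := IsFractionRing.div_surjective (A := PolN n) f
  simp only [map_div₀, actF_algebraMap, actP_mul]

theorem actF_one (f : KK n) : actF n (mEta n) 1 f = f := by
  obtain ⟨a, b, -, rfl⟩ := IsFractionRing.div_surjective (A := PolN n) f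
  simp only [map_div₀, actF_algebraMap, actP_one]

theorem coe_permZ0 (σ : SgN n) (z : Z0 n) (p : IdxN n) :
    (permZ0 n σ z : IdxN n → ℤ) p = (z : IdxN n → ℤ) ((permIdx n (mEta n) σ).symm p) := rfl

theorem permZ0_mul (σ τ : SgN n) (z : Z0 n) :
    permZ0 n (σ * τ) z = permZ0 n σ (permZ0 n τ z) := rfl

theorem permZ0_one (z : Z0 n) : permZ0 n 1 z = z := rfl

/-- The coefficient of `T y` in an element of `V_K`. -/
def coeffV (y : Z0 n) : VK n →ₗ[KK n] KK n := Finsupp.lapply (R := KK n) y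

theorem coeffV_T (y z : Z0 n) [Decidable (z = y)] : coeffV y (T n z) = if z = y then 1 else 0 :=
  Finsupp.single_apply (M := KK n)

theorem vk_ext {x y : VK n} (h : ∀ z, coeffV z x = coeffV z y) : x = y :=
  Finsupp.ext (M := KK n) h

theorem coeffV_sact (σ : SgN n) (x : VK n) (y : Z0 n) :
    coeffV y (sact n σ x) = actF n (mEta n) σ (coeffV (permZ0 n σ⁻¹ y) x) := rfl

theorem sact_add (σ : SgN n) (x y : VK n) : sact n σ (x + y) = sact n σ x + sact n σ y :=
  vk_ext fun z => by simp only [map_add, coeffV_sact]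

theorem sact_zero (σ : SgN n) : sact n σ 0 = 0 :=
  vk_ext fun z => by simp only [map_zero, coeffV_sact]

theorem sact_sub (σ : SgN n) (x y : VK n) : sact n σ (x - y) = sact n σ x - sact n σ y :=
  vk_ext fun z => by simp only [map_sub, coeffV_sact]

theorem sact_smul (σ : SgN n) (f : KK n) (x : VK n) :
    sact n σ (f • x) = actF n (mEta n) σ f • sact n σ x :=
  vk_ext fun z => by simp only [map_smul, coeffV_sact, smul_eq_mul, map_mul]

theorem sact_mul (σ τ : SgN n) (x : VK n) : sact n (σ * τ) x = sact n σ (sact n τ x) :=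
  vk_ext fun z => by simp only [coeffV_sact, actF_mul, mul_inv_rev, permZ0_mul]

theorem sact_one (x : VK n) : sact n 1 x = x :=
  vk_ext fun z => by simp only [coeffV_sact, actF_one, inv_one, permZ0_one]

theorem sact_T (σ : SgN n) (z : Z0 n) : sact n σ (T n z) = T n (permZ0 n σ z) :=
  vk_ext fun y => by
    classical
    rw [coeffV_sact, coeffV_T, coeffV_T]
    have : z = permZ0 n σ⁻¹ y ↔ permZ0 n σ z = y := by
      rw [← (permZ0 n σ).injective.eq_iff, ← permZ0_mul, mul_inv_cancel, permZ0_one]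
    simp only [this]
    split_ifs <;> simp

/-! ### The operators `c_γ` -/

theorem copN_T (γ : PolN n) (z : Z0 n) :
    copN n γ (T n z) =
      shiftK n (z : IdxN n → ℤ) (algebraMap (PolN n) (KK n) γ) • T n z := by
  change (Finsupp.lsum (KK n) _) (Finsupp.single z 1) = _
  rw [Finsupp.lsum_single, LinearMap.toSpanSingleton_apply, one_smul]

theorem shiftK_algebraMap (z : IdxN n → ℤ) (p : PolN n) :
    shiftK n z (algebraMap (PolN n) (KK n) p) = algebraMap (PolN n) (KK n) (shiftP n z p) :=
  IsFractionRing.ringEquivOfRingEquiv_algebraMap _ _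

/-- Induction principle for elements of `V_K`. -/
theorem vk_induction {P : VK n → Prop} (h0 : P 0) (hadd : ∀ x y, P x → P y → P (x + y))
    (hsmul : ∀ (f : KK n) z, P (f • T n z)) (x : VK n) : P x := by
  refine Finsupp.induction_linear (M := KK n) (motive := P) x h0 hadd fun z f => ?_
  have := hsmul f z
  rwa [show f • T n z = Finsupp.single z f from
    (Finsupp.smul_single f z (1 : KK n)).trans (by rw [smul_eq_mul, mul_one])] at this

theorem shiftP_X (z : IdxN n → ℤ) (p : IdxN n) :
    shiftP n z (MvPolynomial.X p) = MvPolynomial.X p + MvPolynomial.C ((z p : ℤ) : ℂ) :=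
  MvPolynomial.aeval_X _ p

theorem actP_shiftP (σ : SgN n) (z : Z0 n) (p : PolN n) :
    actP n (mEta n) σ (shiftP n (z : IdxN n → ℤ) p) =
      shiftP n (permZ0 n σ z : IdxN n → ℤ) (actP n (mEta n) σ p) := by
  induction p using MvPolynomial.induction_on with
  | C a =>
    simp only [actP_apply, MvPolynomial.rename_C]
    rw [show (MvPolynomial.C a : PolN n) = algebraMap ℂ (PolN n) a from rfl,
      AlgEquiv.commutes, AlgEquiv.commutes, AlgHom.commutes]
  | add p q hp hq => simp only [map_add, hp, hq]
  | mul_X p q hp =>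
    rw [map_mul, map_mul, map_mul, map_mul, hp]
    congr 1
    simp only [actP_apply, shiftP_X, map_add, MvPolynomial.rename_X, MvPolynomial.rename_C,
      coe_permZ0, Equiv.symm_apply_apply]

theorem copN_sact {γ : PolN n} (hγ : ∀ σ : SgN n, actP n (mEta n) σ γ = γ) (σ : SgN n)
    (x : VK n) : copN n γ (sact n σ x) = sact n σ (copN n γ x) := by
  induction x using vk_induction with
  | h0 => simp only [sact_zero, map_zero]
  | hadd x y hx hy => simp only [sact_add, map_add, hx, hy]
  | hsmul f z =>
    rw [sact_smul, sact_T, map_smul, map_smul, copN_T, copN_T, sact_smul, sact_smul, sact_T,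
      shiftK_algebraMap, shiftK_algebraMap, actF_algebraMap, actP_shiftP, hγ]

theorem eval_shiftP (v : IdxN n → ℂ) (z : Z0 n) (p : PolN n) :
    MvPolynomial.eval v (shiftP n (z : IdxN n → ℤ) p) = evalVZ n v z p := by
  rw [evalVZ]
  induction p using MvPolynomial.induction_on with
  | C a =>
    rw [show (MvPolynomial.C a : PolN n) = algebraMap ℂ (PolN n) a from rfl, AlgEquiv.commutes]
    simp only [MvPolynomial.algebraMap_eq, MvPolynomial.eval_C]
  | add p q hp hq => simp only [map_add, hp, hq]
  | mul_X p q hp =>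
    rw [map_mul, map_mul, map_mul, hp, shiftP_X]
    simp only [map_add, MvPolynomial.eval_X, MvPolynomial.eval_C]

theorem eval_actP {v : IdxN n → ℂ}
    (hv : ∀ (k : Fin n) (i j : Fin ((k : ℕ) + 1)),
      blk ⟨k, i⟩ = blk ⟨k, j⟩ → v ⟨k, i⟩ = v ⟨k, j⟩)
    {σ : SgN n} (hσ : σ ∈ SgEta n blk) (p : PolN n) :
    MvPolynomial.eval v (actP n (mEta n) σ p) = MvPolynomial.eval v p := by
  rw [actP_apply, MvPolynomial.eval_rename]
  congr 2
  funext q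
  exact hv q.1 _ _ (hσ q)

/-! ### Divided differences -/

/-- The linear form `x_{k,i} - x_{k,i+1}` attached to a letter. -/
def rootP (s : SimpleDat n (mEta n)) : PolN n :=
  MvPolynomial.X ⟨s.1, ⟨s.2.1, Nat.lt_of_succ_lt s.2.2⟩⟩ -
    MvPolynomial.X ⟨s.1, ⟨s.2.1 + 1, s.2.2⟩⟩

theorem rootP_ne_zero (s : SimpleDat n (mEta n)) : rootP s ≠ 0 := by
  intro h
  have := MvPolynomial.X_injective (R := ℂ) (sub_eq_zero.1 h)
  simp [Fin.ext_iff] at this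

/-- The image of `rootP s` in `K`. -/
def rootK (s : SimpleDat n (mEta n)) : KK n := algebraMap (PolN n) (KK n) (rootP s)

theorem rootK_ne_zero (s : SimpleDat n (mEta n)) : rootK s ≠ 0 := by
  rw [rootK, Ne, map_eq_zero_iff _ (IsFractionRing.injective (PolN n) (KK n))]
  exact rootP_ne_zero s

/-- The divided difference attached to a letter. -/
abbrev ddL (s : SimpleDat n (mEta n)) (x : VK n) : VK n := ddV n s.1 s.2.1 s.2.2 x

theorem ddL_eq (s : SimpleDat n (mEta n)) (x : VK n) :
    ddL s x = (rootK s)⁻¹ • (x - sact n (sT s) x) := by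
  rw [rootK, rootP, map_sub]; rfl

theorem sact_eq_sub (s : SimpleDat n (mEta n)) (x : VK n) :
    sact n (sT s) x = x - rootK s • ddL s x := by
  rw [ddL_eq, smul_inv_smul₀ (rootK_ne_zero s), sub_sub_cancel]

theorem ddL_add (s : SimpleDat n (mEta n)) (x y : VK n) :
    ddL s (x + y) = ddL s x + ddL s y := by
  rw [ddL_eq, ddL_eq, ddL_eq, sact_add, ← smul_add, add_sub_add_comm]

theorem ddL_sub (s : SimpleDat n (mEta n)) (x y : VK n) :
    ddL s (x - y) = ddL s x - ddL s y := by
  rw [ddL_eq, ddL_eq, ddL_eq, sact_sub, ← smul_sub, sub_sub_sub_comm]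

theorem ddL_zero (s : SimpleDat n (mEta n)) : ddL s (0 : VK n) = 0 := by
  simp only [ddL_eq, sact_zero, sub_zero, smul_zero]

theorem sub_actP_dvd (s : SimpleDat n (mEta n)) (p : PolN n) :
    rootP s ∣ p - actP n (mEta n) (sT s) p := by
  induction p using MvPolynomial.induction_on with
  | C a => simp only [actP_apply, MvPolynomial.rename_C, sub_self, dvd_zero]
  | add p q hp hq =>
    rw [map_add, add_sub_add_comm]
    exact dvd_add hp hq
  | mul_X p q hp =>
    rw [map_mul, show p * MvPolynomial.X q - actP n (mEta n) (sT s) p *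
        actP n (mEta n) (sT s) (MvPolynomial.X q) =
      (p - actP n (mEta n) (sT s) p) * MvPolynomial.X q + actP n (mEta n) (sT s) p *
        (MvPolynomial.X q - actP n (mEta n) (sT s) (MvPolynomial.X q)) by ring]
    refine dvd_add (Dvd.dvd.mul_right hp _) (Dvd.dvd.mul_left ?_ _)
    rw [actP_apply, MvPolynomial.rename_X]
    obtain ⟨k, i, h⟩ := s
    obtain ⟨l, a⟩ := q
    by_cases hl : l = k
    · subst hl
      change _ ∣ MvPolynomial.X _ - MvPolynomial.X (⟨l, simpleT n (mEta n) l i h l a⟩ : IdxN n)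
      rw [simpleT_same, adjSwap, Equiv.swap_apply_def, rootP]
      split_ifs with h1 h2
      · rw [h1]
      · rw [h2]; exact (dvd_sub_comm).1 dvd_rfl
      · rw [sub_self]; exact dvd_zero _
    · change _ ∣ MvPolynomial.X _ - MvPolynomial.X (⟨l, simpleT n (mEta n) k i h l a⟩ : IdxN n)
      rw [simpleT_ne k i h hl, Equiv.Perm.one_apply, sub_self]; exact dvd_zero _

/-- The divided difference of a polynomial. -/
def ddP (s : SimpleDat n (mEta n)) (p : PolN n) : PolN n := (sub_actP_dvd s p).choose

theorem ddP_spec (s : SimpleDat n (mEta n)) (p : PolN n) :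
    p - actP n (mEta n) (sT s) p = rootP s * ddP s p := (sub_actP_dvd s p).choose_spec

theorem leibniz_aux {K V : Type*} [Field K] [AddCommGroup V] [Module K V] (a f g : K)
    (x y : V) : a • (f • x - g • y) = (a * (f - g)) • x + g • (a • (x - y)) := by
  module

/-- The twisted Leibniz rule. -/
theorem ddL_smul (s : SimpleDat n (mEta n)) (p : PolN n) (x : VK n) :
    ddL s (algebraMap (PolN n) (KK n) p • x) = algebraMap (PolN n) (KK n) (ddP s p) • x +
      algebraMap (PolN n) (KK n) (actP n (mEta n) (sT s) p) • ddL s x := by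
  have h : algebraMap (PolN n) (KK n) (ddP s p) = (rootK s)⁻¹ *
      (algebraMap (PolN n) (KK n) p -
        algebraMap (PolN n) (KK n) (actP n (mEta n) (sT s) p)) := by
    rw [← map_sub, ddP_spec, map_mul, ← rootK, inv_mul_cancel_left₀ (rootK_ne_zero s)]
  rw [h, ddL_eq, ddL_eq, sact_smul, actF_algebraMap]
  exact leibniz_aux _ _ _ _ _

theorem ddWordV_cons (s : SimpleDat n (mEta n)) (w : Word n (mEta n)) (x : VK n) :
    ddWordV n (s :: w) x = ddL s (ddWordV n w x) := rfl

theorem ddL_of_sact_eq {s : SimpleDat n (mEta n)} {x : VK n} (h : sact n (sT s) x = x) :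
    ddL s x = 0 := by
  rw [ddL_eq, h, sub_self, smul_zero]

theorem neg_inv_smul_sub {K V : Type*} [Field K] [AddCommGroup V] [Module K V] (a : K)
    (x y : V) : (-a)⁻¹ • (y - x) = a⁻¹ • (x - y) := by
  rw [inv_neg, neg_smul, ← smul_neg, neg_sub]

theorem ddL_ddL (s : SimpleDat n (mEta n)) (x : VK n) : ddL s (ddL s x) = 0 := by
  apply ddL_of_sact_eq
  have hs : actP n (mEta n) (sT s) (rootP s) = - rootP s := by
    obtain ⟨k, i, h⟩ := s
    rw [rootP, map_sub, actP_apply, actP_apply, MvPolynomial.rename_X, MvPolynomial.rename_X]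
    change MvPolynomial.X (⟨k, simpleT n (mEta n) k i h k _⟩ : IdxN n) -
      MvPolynomial.X (⟨k, simpleT n (mEta n) k i h k _⟩ : IdxN n) = _
    rw [simpleT_same, adjSwap, Equiv.swap_apply_left, Equiv.swap_apply_right, neg_sub]
  rw [ddL_eq, sact_smul, map_inv₀, rootK, actF_algebraMap, hs, sact_sub, ← sact_mul,
    simpleT_mul_self, sact_one, map_neg]
  exact neg_inv_smul_sub _ _ _

theorem copN_ddL {γ : PolN n} (hγ : ∀ σ : SgN n, actP n (mEta n) σ γ = γ)
    (s : SimpleDat n (mEta n)) (x : VK n) : copN n γ (ddL s x) = ddL s (copN n γ x) := by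
  rw [ddL_eq, ddL_eq, map_smul, map_sub, copN_sact hγ]

theorem copN_ddWordV {γ : PolN n} (hγ : ∀ σ : SgN n, actP n (mEta n) σ γ = γ)
    (w : Word n (mEta n)) (x : VK n) :
    copN n γ (ddWordV n w x) = ddWordV n w (copN n γ x) := by
  induction w with
  | nil => rfl
  | cons s w ih => rw [ddWordV_cons, ddWordV_cons, copN_ddL hγ, ih]

theorem ddWordV_zero (w : Word n (mEta n)) : ddWordV n w (0 : VK n) = 0 := by
  induction w with
  | nil => rfl
  | cons s w ih => rw [ddWordV_cons, ih, ddL_zero]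

theorem ddWordV_append (w w' : Word n (mEta n)) (x : VK n) :
    ddWordV n (w ++ w') x = ddWordV n w (ddWordV n w' x) := by
  simp [ddWordV]

/-! ### Normal forms and shuffles -/

theorem permZ0_inv_apply (σ : SgN n) (z : Z0 n) (k : Fin n) (i : Fin (mEta n k)) :
    (permZ0 n σ⁻¹ z : IdxN n → ℤ) ⟨k, i⟩ = (z : IdxN n → ℤ) ⟨k, σ k i⟩ := rfl

theorem permZ0_sT_eq {s : SimpleDat n (mEta n)} {z : Z0 n}
    (h : (z : IdxN n → ℤ) ⟨s.1, ⟨s.2.1, Nat.lt_of_succ_lt s.2.2⟩⟩ =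
      (z : IdxN n → ℤ) ⟨s.1, ⟨s.2.1 + 1, s.2.2⟩⟩) : permZ0 n (sT s) z = z := by
  obtain ⟨k, i, hi⟩ := s
  rw [sT, ← simpleT_inv]
  apply Subtype.ext
  funext ⟨l, a⟩
  rw [permZ0_inv_apply]
  by_cases hl : l = k
  · subst hl
    rw [simpleT_same, adjSwap, Equiv.swap_apply_def]
    split_ifs with h1 h2
    · rw [h1]; exact h.symm
    · rw [h2]; exact h
    · rfl
  · rw [simpleT_ne k i hi hl]; rfl

theorem exists_adjacent_descent {f : ℕ → ℕ} {i j : ℕ} (hij : i ≤ j) (h : f j < f i) :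
    ∃ l, i ≤ l ∧ l < j ∧ f (l + 1) < f l := by
  by_contra! hc
  have : ∀ l, i ≤ l → l ≤ j → f i ≤ f l := by
    intro l hl
    induction l, hl using Nat.le_induction with
    | base => intro _; rfl
    | succ l hl ih => intro hlj; exact (ih (by omega)).trans (hc l hl (by omega))
  exact absurd (this j hij le_rfl) (not_le.2 h)

/-- An element of `S_η` that is not a shuffle for `z` has a descent at a letter fixing `z`. -/
theorem exists_descent_of_not_isShuffle
    (hmono : ∀ k : Fin n, Monotone fun i : Fin ((k : ℕ) + 1) => blk ⟨k, i⟩)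
    {z : Z0 n} (hz : z ∈ Nset n blk) {σ : SgN n} (hσ : σ ∈ SgEta n blk)
    (hs : ¬ IsShuffle n blk z σ) :
    ∃ s : SimpleDat n (mEta n), LetBlk blk s ∧ permZ0 n (sT s) z = z ∧
      σ s.1 ⟨s.2.1 + 1, s.2.2⟩ < σ s.1 ⟨s.2.1, Nat.lt_of_succ_lt s.2.2⟩ := by
  have : ¬ ∀ (k : Fin n) (i j : Fin ((k : ℕ) + 1)), i < j → blk ⟨k, i⟩ = blk ⟨k, j⟩ →
      (z : IdxN n → ℤ) ⟨k, i⟩ = (z : IdxN n → ℤ) ⟨k, j⟩ → σ k i < σ k j := fun h => hs ⟨hσ, h⟩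
  push Not at this
  obtain ⟨k, i, j, hij, hb, he, hle⟩ := this
  have hlt : σ k j < σ k i := lt_of_le_of_ne hle fun h => hij.ne' ((σ k).injective h)
  obtain ⟨l, hil, hlj, hd⟩ := exists_adjacent_descent
    (f := fun l => if h : l < (k : ℕ) + 1 then (σ k ⟨l, h⟩ : ℕ) else 0)
    (i := i) (j := j) hij.le (by rw [dif_pos i.2, dif_pos j.2]; exact hlt)
  have hl1 : l + 1 < (k : ℕ) + 1 := by have := j.2; omega
  rw [dif_pos hl1, dif_pos (Nat.lt_of_succ_lt hl1)] at hd
  have h1 : i ≤ ⟨l, Nat.lt_of_succ_lt hl1⟩ := hil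
  have h2 : (⟨l, Nat.lt_of_succ_lt hl1⟩ : Fin ((k : ℕ) + 1)) ≤ ⟨l + 1, hl1⟩ := by
    simp [Fin.le_def]
  have h3 : (⟨l + 1, hl1⟩ : Fin ((k : ℕ) + 1)) ≤ j := hlj
  have hb1 := hmono k h1
  have hb2 := hmono k h2
  have hb3 := hmono k h3
  simp only at hb1 hb2 hb3
  have e1 : blk ⟨k, i⟩ = blk ⟨k, ⟨l, Nat.lt_of_succ_lt hl1⟩⟩ := by omega
  have e2 : blk ⟨k, ⟨l, Nat.lt_of_succ_lt hl1⟩⟩ = blk ⟨k, ⟨l + 1, hl1⟩⟩ := by omega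
  have e3 : blk ⟨k, ⟨l + 1, hl1⟩⟩ = blk ⟨k, j⟩ := by omega
  have hz1 := hz k _ _ h1 e1
  have hz2 := hz k _ _ h2 e2
  have hz3 := hz k _ _ h3 e3
  exact ⟨⟨k, l, hl1⟩, e2, permZ0_sT_eq (by simp only; omega), hd⟩

/-- Every orbit point of `z ∈ N_η` is reached by a shuffle of minimal length. -/
theorem exists_isShuffle_min
    (hmono : ∀ k : Fin n, Monotone fun i : Fin ((k : ℕ) + 1) => blk ⟨k, i⟩)
    {z : Z0 n} (hz : z ∈ Nset n blk) {ρ : SgN n} (hρ : ρ ∈ SgEta n blk) :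
    ∃ σ, IsShuffle n blk z σ ∧ permZ0 n σ z = permZ0 n ρ z ∧
      ∀ τ ∈ SgEta n blk, permZ0 n τ z = permZ0 n ρ z → len n (mEta n) σ ≤ len n (mEta n) τ := by
  obtain ⟨σ, ⟨hσ, hσz⟩, hmin⟩ := Set.exists_min_image
    {τ : SgN n | τ ∈ SgEta n blk ∧ permZ0 n τ z = permZ0 n ρ z} (len n (mEta n))
    (Set.toFinite _) ⟨ρ, hρ, rfl⟩
  refine ⟨σ, ?_, hσz, fun τ hτ h => hmin τ ⟨hτ, h⟩⟩
  by_contra hs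
  obtain ⟨s, hsb, hsz, hlt⟩ := exists_descent_of_not_isShuffle hmono hz hσ hs
  have hlen : len n (mEta n) (σ * sT s) + 1 = len n (mEta n) σ :=
    len_mul_simpleT_of_gt σ s.1 s.2.1 s.2.2 hlt
  have := hmin (σ * sT s) ⟨mul_mem hσ (sT_mem hsb), by rw [permZ0_mul, hsz, hσz]⟩
  omega

theorem isShuffle_unique
    (hmono : ∀ k : Fin n, Monotone fun i : Fin ((k : ℕ) + 1) => blk ⟨k, i⟩)
    {z : Z0 n} (hz : z ∈ Nset n blk) {σ τ : SgN n} (hσ : IsShuffle n blk z σ)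
    (hτ : IsShuffle n blk z τ) (h : permZ0 n σ z = permZ0 n τ z) : σ = τ := by
  set ρ := σ⁻¹ * τ with hρ
  have hρz : permZ0 n ρ⁻¹ z = z := by
    rw [hρ, mul_inv_rev, inv_inv, permZ0_mul, h, ← permZ0_mul, inv_mul_cancel, permZ0_one]
  have hρb : ρ ∈ SgEta n blk := mul_mem (inv_mem hσ.1) hτ.1
  have hρb := mem_SgEta.1 hρb
  have hz' : ∀ (k : Fin n) (i : Fin (mEta n k)),
      (z : IdxN n → ℤ) ⟨k, ρ k i⟩ = (z : IdxN n → ℤ) ⟨k, i⟩ := by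
    intro k i
    rw [← permZ0_inv_apply, hρz]
  have hστ : ∀ (k : Fin n) (i : Fin (mEta n k)), σ k (ρ k i) = τ k i := by
    intro k i; simp [hρ]
  suffices ρ = 1 from (inv_mul_eq_one.1 (hρ ▸ this))
  funext k
  refine perm_eq_one_of_strictMono fun i j hij => ?_
  rcases (hmono k hij.le).lt_or_eq with hb | hb
  · refine lt_of_blk_lt hmono (k := k) ?_
    rw [hρb, hρb]; exact hb
  · have hb : blk ⟨k, i⟩ = blk ⟨k, j⟩ := hb
    have hb' : blk ⟨k, ρ k j⟩ = blk ⟨k, ρ k i⟩ := by rw [hρb, hρb, hb]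
    by_contra hc
    have hc : ρ k j ≤ ρ k i := not_lt.1 hc
    have h1 := hz k _ _ hc hb'
    rw [hz', hz'] at h1
    have h2 := hz k _ _ hij.le hb
    have h3 := hτ.2 k i j hij hb (le_antisymm h1 h2)
    have h4 := hσ.2 k _ _ (lt_of_le_of_ne hc fun h => hij.ne' ((ρ k).injective h)) hb'
      (by rw [hz', hz']; exact le_antisymm h2 h1)
    rw [hστ, hστ] at h4
    exact lt_asymm h3 h4

theorem len_le_of_isShuffle
    (hmono : ∀ k : Fin n, Monotone fun i : Fin ((k : ℕ) + 1) => blk ⟨k, i⟩)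
    {z : Z0 n} (hz : z ∈ Nset n blk) {σ τ : SgN n} (hσ : IsShuffle n blk z σ)
    (hτ : τ ∈ SgEta n blk) (h : permZ0 n τ z = permZ0 n σ z) :
    len n (mEta n) σ ≤ len n (mEta n) τ := by
  obtain ⟨ρ, hρ, hρz, hmin⟩ := exists_isShuffle_min hmono hz hσ.1
  obtain rfl := isShuffle_unique hmono hz hρ hσ hρz
  exact hmin τ hτ h

theorem card_isShuffle_mul_card_stabilizer
    (hmono : ∀ k : Fin n, Monotone fun i : Fin ((k : ℕ) + 1) => blk ⟨k, i⟩)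
    {z : Z0 n} (hz : z ∈ Nset n blk) :
    Nat.card {σ : SgN n // IsShuffle n blk z σ} *
      Nat.card {σ : SgN n // σ ∈ SgEta n blk ∧ permZ0 n σ z = z} = etaFactB n blk := by
  rw [← Nat.card_prod, etaFactB]
  refine Nat.card_congr (Equiv.ofBijective
    (fun p => ⟨p.1.1 * p.2.1, mul_mem p.1.2.1 p.2.2.1⟩) ⟨?_, ?_⟩)
  · rintro ⟨⟨σ, hσ⟩, ⟨τ, hτ⟩⟩ ⟨⟨σ', hσ'⟩, ⟨τ', hτ'⟩⟩ h
    have h : σ * τ = σ' * τ' := congrArg Subtype.val h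
    have hz' : permZ0 n σ z = permZ0 n σ' z := by
      have := congrArg (fun ρ => permZ0 n ρ z) h
      simpa only [permZ0_mul, hτ.2, hτ'.2] using this
    obtain rfl := isShuffle_unique hmono hz hσ hσ' hz'
    obtain rfl := mul_left_cancel h
    rfl
  · rintro ⟨ρ, hρ⟩
    obtain ⟨σ, hσ, hσz, -⟩ := exists_isShuffle_min hmono hz hρ
    refine ⟨⟨⟨σ, hσ⟩, ⟨σ⁻¹ * ρ, mul_mem (inv_mem hσ.1) hρ, ?_⟩⟩, Subtype.ext (by simp)⟩
    rw [permZ0_mul, ← hσz, ← permZ0_mul, inv_mul_cancel, permZ0_one]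

/-- A row of `z`, ordered lexicographically by block and decreasing entry. -/
def rowKey (blk : IdxN n → ℕ) (z : Z0 n) (k : Fin n) (i : Fin (mEta n k)) : ℕ ×ₗ ℤ :=
  toLex (blk ⟨k, i⟩, - (z : IdxN n → ℤ) ⟨k, i⟩)

theorem rowKey_monotone
    (hmono : ∀ k : Fin n, Monotone fun i : Fin ((k : ℕ) + 1) => blk ⟨k, i⟩)
    {z : Z0 n} (hz : z ∈ Nset n blk) (k : Fin n) : Monotone (rowKey blk z k) := by
  intro i j hij
  rw [rowKey, rowKey, Prod.Lex.toLex_le_toLex]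
  rcases (hmono k hij).lt_or_eq with hb | hb
  · exact Or.inl hb
  · exact Or.inr ⟨hb, neg_le_neg (hz k i j hij hb)⟩

theorem rowKey_permZ0_inv {σ : SgN n} (hσ : σ ∈ SgEta n blk) (z : Z0 n) (k : Fin n) :
    rowKey blk (permZ0 n σ⁻¹ z) k = rowKey blk z k ∘ σ k := by
  funext i
  simp only [rowKey, Function.comp, permZ0_inv_apply, mem_SgEta.1 hσ]

/-- Distinct elements of `N_η` lie in distinct `S_η`-orbits. -/
theorem nset_unique (hmono : ∀ k : Fin n, Monotone fun i : Fin ((k : ℕ) + 1) => blk ⟨k, i⟩)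
    {y z : Z0 n} (hy : y ∈ Nset n blk) (hz : z ∈ Nset n blk) {σ : SgN n}
    (hσ : σ ∈ SgEta n blk) (h : permZ0 n σ z = y) : z = y := by
  have hσ' := inv_mem hσ
  have h' : permZ0 n (σ⁻¹)⁻¹ z = y := by rw [inv_inv, h]
  apply Subtype.ext
  funext ⟨k, i⟩
  have := Tuple.unique_monotone (f := rowKey blk z k) (σ := 1) (τ := σ⁻¹ k)
    (rowKey_monotone hmono hz k)
    (by rw [← rowKey_permZ0_inv hσ', h']; exact rowKey_monotone hmono hy k)
  rw [← rowKey_permZ0_inv hσ', h'] at this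
  have := congrArg (fun q => (ofLex q).2) (congrFun this i)
  simpa [rowKey] using this

/-- Every `S_η`-orbit meets `N_η`. -/
theorem exists_nset (hmono : ∀ k : Fin n, Monotone fun i : Fin ((k : ℕ) + 1) => blk ⟨k, i⟩)
    (y : Z0 n) : ∃ z ∈ Nset n blk, ∃ σ ∈ SgEta n blk, permZ0 n σ z = y := by
  let ρ : SgN n := fun k => Tuple.sort (rowKey blk y k)
  have hρm : ∀ k, Monotone (rowKey blk y k ∘ ρ k) := fun k => Tuple.monotone_sort _
  have hρ : ρ ∈ SgEta n blk := by
    rw [mem_SgEta]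
    intro k i
    have := Tuple.unique_monotone (f := fun i : Fin (mEta n k) => blk ⟨k, i⟩) (σ := ρ k) (τ := 1)
      (fun i j hij => Prod.Lex.monotone_fst _ _ (hρm k hij)) (hmono k)
    exact congrFun this i
  refine ⟨permZ0 n ρ⁻¹ y, ?_, ρ, hρ, by rw [← permZ0_mul, mul_inv_cancel, permZ0_one]⟩
  intro k i j hij hb
  have := hρm k hij
  simp only [Function.comp, rowKey, mem_SgEta.1 hρ] at this
  rw [hb, Prod.Lex.toLex_le_toLex] at this
  simp only [lt_irrefl, false_or, true_and, neg_le_neg_iff] at this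
  exact this

/-! ### Separation of characters -/

theorem exists_perm_of_multiset_eq {m : ℕ} {α : Type*} {a b : Fin m → α}
    (h : Finset.univ.val.map a = Finset.univ.val.map b) :
    ∃ σ : Equiv.Perm (Fin m), ∀ i, b (σ i) = a i := by
  classical
  have hc : ∀ c, Nonempty ({i // a i = c} ≃ {i // b i = c}) := by
    intro c
    rw [← Fintype.card_eq, Fintype.card_subtype, Fintype.card_subtype]
    have := congrArg (Multiset.count c) h
    rw [Multiset.count_map, Multiset.count_map] at this
    simp only [eq_comm (a := c)] at this
    exact this
  let e := fun c => (hc c).some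
  refine ⟨(Equiv.sigmaFiberEquiv a).symm.trans
    ((Equiv.sigmaCongrRight e).trans (Equiv.sigmaFiberEquiv b)), fun i => ?_⟩
  exact (e (a i) ⟨i, rfl⟩).2

/-- The invariant polynomial `∏_i (t - x_{k,i})`. -/
def rowPoly (k : Fin n) (t : ℂ) : PolN n :=
  ∏ i : Fin (mEta n k), (MvPolynomial.C t - MvPolynomial.X ⟨k, i⟩)

theorem actP_rowPoly (σ : SgN n) (k : Fin n) (t : ℂ) :
    actP n (mEta n) σ (rowPoly k t) = rowPoly k t := by
  rw [rowPoly, map_prod]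
  refine Fintype.prod_equiv (σ k) _ _ fun i => ?_
  rw [actP_apply, map_sub, MvPolynomial.rename_C, MvPolynomial.rename_X]
  rfl

theorem evalVZ_rowPoly (v : IdxN n → ℂ) (z : Z0 n) (k : Fin n) (t : ℂ) :
    evalVZ n v z (rowPoly k t) =
      ∏ i : Fin (mEta n k), (t - (v ⟨k, i⟩ + ((z : IdxN n → ℤ) ⟨k, i⟩ : ℂ))) := by
  simp [evalVZ, rowPoly]

theorem eq_of_evalVZ_eq
    (hmono : ∀ k : Fin n, Monotone fun i : Fin ((k : ℕ) + 1) => blk ⟨k, i⟩)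
    {v : IdxN n → ℂ}
    (hcrit1 : ∀ (k : Fin n) (i j : Fin ((k : ℕ) + 1)), (k : ℕ) + 1 < n →
      ((∃ c : ℤ, v ⟨k, i⟩ - v ⟨k, j⟩ = (c : ℂ)) ↔ blk ⟨k, i⟩ = blk ⟨k, j⟩))
    (hcrit2 : ∀ (k : Fin n) (i j : Fin ((k : ℕ) + 1)),
      blk ⟨k, i⟩ = blk ⟨k, j⟩ → v ⟨k, i⟩ = v ⟨k, j⟩)
    {y z : Z0 n} (hy : y ∈ Nset n blk) (hz : z ∈ Nset n blk)
    (h : ∀ γ : PolN n, (∀ σ : SgN n, actP n (mEta n) σ γ = γ) →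
      evalVZ n v y γ = evalVZ n v z γ) : y = z := by
  have hperm : ∀ k : Fin n, ∃ σ : Equiv.Perm (Fin (mEta n k)), ∀ i,
      v ⟨k, σ i⟩ + ((z : IdxN n → ℤ) ⟨k, σ i⟩ : ℂ) = v ⟨k, i⟩ + ((y : IdxN n → ℤ) ⟨k, i⟩ : ℂ) := by
    intro k
    refine exists_perm_of_multiset_eq (b := fun i => v ⟨k, i⟩ + ((z : IdxN n → ℤ) ⟨k, i⟩ : ℂ)) ?_
    rw [← Polynomial.roots_multiset_prod_X_sub_C
      (Finset.univ.val.map fun i => v ⟨k, i⟩ + ((y : IdxN n → ℤ) ⟨k, i⟩ : ℂ)),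
      ← Polynomial.roots_multiset_prod_X_sub_C
      (Finset.univ.val.map fun i => v ⟨k, i⟩ + ((z : IdxN n → ℤ) ⟨k, i⟩ : ℂ)),
      Multiset.map_map, Multiset.map_map]
    congr 1
    refine Polynomial.funext fun t => ?_
    have := h (rowPoly k t) fun σ => actP_rowPoly σ k t
    rw [evalVZ_rowPoly, evalVZ_rowPoly] at this
    change Polynomial.eval t (∏ i, (Polynomial.X - Polynomial.C _)) =
      Polynomial.eval t (∏ i, (Polynomial.X - Polynomial.C _))
    simpa only [Polynomial.eval_prod, Polynomial.eval_sub, Polynomial.eval_X,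
      Polynomial.eval_C] using this
  choose σ hσ using hperm
  let τ : SgN n := fun k => if (k : ℕ) + 1 = n then 1 else σ k
  have key : ∀ (k : Fin n) (i : Fin (mEta n k)), blk ⟨k, τ k i⟩ = blk ⟨k, i⟩ ∧
      (z : IdxN n → ℤ) ⟨k, τ k i⟩ = (y : IdxN n → ℤ) ⟨k, i⟩ := by
    intro k i
    by_cases hk : (k : ℕ) + 1 = n
    · simp only [τ, if_pos hk, Equiv.Perm.one_apply, true_and]
      rw [z.2 _ hk, y.2 _ hk]
    · simp only [τ, if_neg hk]
      have hk' : (k : ℕ) + 1 < n := by have := k.2; omega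
      have hb : blk ⟨k, σ k i⟩ = blk ⟨k, i⟩ := (hcrit1 k _ _ hk').1
        ⟨(y : IdxN n → ℤ) ⟨k, i⟩ - (z : IdxN n → ℤ) ⟨k, σ k i⟩, by
          push_cast; linear_combination hσ k i⟩
      refine ⟨hb, ?_⟩
      have h1 := hσ k i
      rw [hcrit2 k _ _ hb] at h1
      exact_mod_cast add_left_cancel h1
  refine (nset_unique hmono hy hz (σ := τ⁻¹) (inv_mem (mem_SgEta.2 fun k i => (key k i).1))
    ?_).symm
  apply Subtype.ext
  funext ⟨k, i⟩
  rw [permZ0_inv_apply]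
  exact (key k i).2

/-! ### Divided differences along elements of `S_η` -/

/-- The operators `PdV σ` are computed by reduced words, for all `σ ∈ S_η`. -/
def IsDD (blk : IdxN n → ℕ) (PdV : SgN n → VK n → VK n) : Prop :=
  ∀ σ ∈ SgEta n blk, ∀ w : Word n (mEta n), IsRedB n blk σ w → ∀ x : VK n,
    PdV σ x = ddWordV n w x

/-- `blk` is weakly increasing along each row. -/
def RowMono (blk : IdxN n → ℕ) : Prop :=
  ∀ k : Fin n, Monotone fun i : Fin ((k : ℕ) + 1) => blk ⟨k, i⟩

variable {PdV : SgN n → VK n → VK n}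

theorem PdV_one (hP : IsDD blk PdV) (x : VK n) : PdV 1 x = x :=
  hP 1 (one_mem _) [] ⟨⟨rfl, by simp [len_one]⟩, by simp [WordBlk]⟩ x

theorem isRedB_cons {σ : SgN n} {s : SimpleDat n (mEta n)} (hs : LetBlk blk s)
    (hl : len n (mEta n) (sT s * σ) = len n (mEta n) σ + 1) {w : Word n (mEta n)}
    (hw : IsRedB n blk σ w) : IsRedB n blk (sT s * σ) (s :: w) := by
  obtain ⟨⟨h1, h2⟩, h3⟩ := hw
  refine ⟨⟨by rw [wordPerm_cons, h1], by rw [List.length_cons, h2, hl]⟩, ?_⟩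
  intro t ht
  rcases List.mem_cons.1 ht with rfl | ht
  · exact hs
  · exact h3 t ht

theorem ddL_PdV (hm : RowMono blk) (hP : IsDD blk PdV) {σ : SgN n} (hσ : σ ∈ SgEta n blk)
    {s : SimpleDat n (mEta n)} (hs : LetBlk blk s) (x : VK n) :
    (len n (mEta n) (sT s * σ) = len n (mEta n) σ + 1 ∧ ddL s (PdV σ x) = PdV (sT s * σ) x) ∨
      ddL s (PdV σ x) = 0 := by
  rcases len_simpleT_mul σ s.1 s.2.1 s.2.2 with hl | hl
  · left
    obtain ⟨w, hw⟩ := exists_isRedB hm hσ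
    refine ⟨hl, ?_⟩
    rw [hP σ hσ w hw, hP _ (mul_mem (sT_mem hs) hσ) _ (isRedB_cons hs hl hw), ddWordV_cons]
  · right
    have hs' : sT s * (sT s * σ) = σ := by rw [← mul_assoc, simpleT_mul_self, one_mul]
    obtain ⟨w, hw⟩ := exists_isRedB hm (mul_mem (sT_mem hs) hσ)
    have := isRedB_cons hs (by rw [hs']; exact hl.symm) hw
    rw [hs'] at this
    rw [hP σ hσ _ this, ddWordV_cons, ddL_ddL]

theorem ddWordV_eq (hm : RowMono blk) (hP : IsDD blk PdV) {w : Word n (mEta n)}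
    (hw : WordBlk n blk w) (x : VK n) :
    ddWordV n w x = 0 ∨
      ∃ σ ∈ SgEta n blk, len n (mEta n) σ = w.length ∧ ddWordV n w x = PdV σ x := by
  induction w with
  | nil => exact Or.inr ⟨1, one_mem _, len_one, (PdV_one hP x).symm⟩
  | cons s w ih =>
    have hs : LetBlk blk s := hw s (by simp)
    rw [ddWordV_cons]
    rcases ih fun t ht => hw t (by simp [ht]) with h0 | ⟨σ, hσ, hl, h⟩
    · left; rw [h0, ddL_zero]
    · rw [h]
      rcases ddL_PdV hm hP hσ hs x with ⟨hl', h'⟩ | h'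
      · exact Or.inr ⟨_, mul_mem (sT_mem hs) hσ, by rw [hl', hl, List.length_cons], h'⟩
      · exact Or.inl h'

theorem PdV_eq_zero (hm : RowMono blk) (hP : IsDD blk PdV) {z : Z0 n} (hz : z ∈ Nset n blk)
    {σ : SgN n} (hσ : σ ∈ SgEta n blk) (hs : ¬ IsShuffle n blk z σ) : PdV σ (T n z) = 0 := by
  obtain ⟨s, hsb, hsz, hlt⟩ := exists_descent_of_not_isShuffle hm hz hσ hs
  have hlen : len n (mEta n) (σ * sT s) + 1 = len n (mEta n) σ :=
    len_mul_simpleT_of_gt σ s.1 s.2.1 s.2.2 hlt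
  obtain ⟨w, ⟨h1, h2⟩, h3⟩ := exists_isRedB hm (mul_mem hσ (sT_mem hsb))
  have hw : IsRedB n blk σ (w ++ [s]) := by
    refine ⟨⟨?_, ?_⟩, ?_⟩
    · rw [wordPerm_append, h1, wordPerm_cons, mul_assoc, ← mul_assoc (sT s), simpleT_mul_self]
      simp [wordPerm]
    · rw [List.length_append, h2, ← hlen]; rfl
    · intro t ht
      rcases List.mem_append.1 ht with ht | ht
      · exact h3 t ht
      · rw [List.mem_singleton.1 ht]; exact hsb
  rw [hP σ hσ _ hw, ddWordV_append, ddWordV_cons]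
  change ddWordV n w (ddL s (T n z)) = 0
  rw [ddL_of_sact_eq (by rw [sact_T, hsz]), ddWordV_zero]

/-! ### Spans with polynomial coefficients -/

/-- The polynomial ring as a subalgebra of `K`. -/
def Palg (n : ℕ) : Subalgebra ℂ (KK n) := (IsScalarTower.toAlgHom ℂ (PolN n) (KK n)).range

/-- The span of a subset of `V_K` with polynomial coefficients. -/
def pspan (S : Set (VK n)) : Submodule ↥(Palg n) (VK n) := Submodule.span _ S

theorem pspan_smul {S : Set (VK n)} (p : PolN n) {x : VK n} (hx : x ∈ pspan S) :
    algebraMap (PolN n) (KK n) p • x ∈ pspan S :=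
  (pspan S).smul_mem (⟨algebraMap (PolN n) (KK n) p, ⟨p, rfl⟩⟩ : ↥(Palg n)) hx

theorem pspan_induction {S : Set (VK n)} {Q : VK n → Prop} (hS : ∀ x ∈ S, Q x) (h0 : Q 0)
    (hadd : ∀ x y, Q x → Q y → Q (x + y))
    (hsmul : ∀ (p : PolN n) x, x ∈ pspan S → Q x → Q (algebraMap (PolN n) (KK n) p • x))
    {x : VK n} (hx : x ∈ pspan S) : Q x := by
  refine Submodule.span_induction (p := fun x _ => Q x) hS h0 (fun x y _ _ => hadd x y) ?_ hx
  rintro ⟨-, p, rfl⟩ x hx h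
  exact hsmul p x hx h

/-- The span of the `PdV σ (T z)` with `σ ∈ S_η` of length in `S`. -/
def Wd (blk : IdxN n → ℕ) (PdV : SgN n → VK n → VK n) (z : Z0 n) (S : Set ℕ) :
    Submodule ↥(Palg n) (VK n) :=
  pspan {x | ∃ σ ∈ SgEta n blk, len n (mEta n) σ ∈ S ∧ x = PdV σ (T n z)}

theorem PdV_mem_Wd {z : Z0 n} {S : Set ℕ} {σ : SgN n} (hσ : σ ∈ SgEta n blk)
    (hS : len n (mEta n) σ ∈ S) : PdV σ (T n z) ∈ Wd blk PdV z S :=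
  Submodule.subset_span ⟨σ, hσ, hS, rfl⟩

theorem Wd_mono {z : Z0 n} {S S' : Set ℕ} (h : S ⊆ S') : Wd blk PdV z S ≤ Wd blk PdV z S' :=
  Submodule.span_mono fun _ ⟨σ, hσ, hS, hx⟩ => ⟨σ, hσ, h hS, hx⟩

theorem ddL_mem_Wd (hm : RowMono blk) (hP : IsDD blk PdV) {z : Z0 n} {S S' : Set ℕ}
    (h : S ⊆ S') (h' : ∀ l ∈ S, l + 1 ∈ S') {s : SimpleDat n (mEta n)} (hs : LetBlk blk s)
    {x : VK n} (hx : x ∈ Wd blk PdV z S) : ddL s x ∈ Wd blk PdV z S' := by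
  refine pspan_induction (Q := fun x => ddL s x ∈ Wd blk PdV z S') ?_ ?_ ?_ ?_ hx
  · rintro _ ⟨σ, hσ, hS, rfl⟩
    rcases ddL_PdV hm hP hσ hs (T n z) with ⟨hl, he⟩ | he
    · rw [he]; exact PdV_mem_Wd (mul_mem (sT_mem hs) hσ) (by rw [hl]; exact h' _ hS)
    · rw [he]; exact zero_mem _
  · rw [ddL_zero]; exact zero_mem _
  · intro x y hx hy
    rw [ddL_add]; exact add_mem hx hy
  · intro p x hx ih
    rw [ddL_smul]
    exact add_mem (pspan_smul _ (Wd_mono h hx)) (pspan_smul _ ih)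

theorem sact_mem_Wd (hm : RowMono blk) (hP : IsDD blk PdV) {z : Z0 n} {σ : SgN n}
    (hσ : σ ∈ SgEta n blk) {x : VK n} (hx : x ∈ Wd blk PdV z Set.univ) :
    sact n σ x ∈ Wd blk PdV z Set.univ := by
  obtain ⟨w, ⟨rfl, -⟩, hw⟩ := exists_isRedB hm hσ
  clear hσ
  induction w with
  | nil => rw [show wordPerm n (mEta n) [] = 1 from rfl, sact_one]; exact hx
  | cons s w ih =>
    rw [wordPerm_cons, sact_mul, sact_eq_sub]
    have := ih fun t ht => hw t (by simp [ht])
    exact sub_mem this (pspan_smul _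
      (ddL_mem_Wd (S := Set.univ) hm hP subset_rfl (fun _ _ => Set.mem_univ _) (hw s (by simp)) this))

theorem ddWordV_mem_Wd (hm : RowMono blk) (hP : IsDD blk PdV) {z : Z0 n} {w : Word n (mEta n)}
    (hw : WordBlk n blk w) {x : VK n} (hx : x ∈ Wd blk PdV z Set.univ) :
    ddWordV n w x ∈ Wd blk PdV z Set.univ := by
  induction w with
  | nil => exact hx
  | cons s w ih =>
    rw [ddWordV_cons]
    exact ddL_mem_Wd (S := Set.univ) hm hP subset_rfl (fun _ _ => Set.mem_univ _) (hw s (by simp))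
      (ih fun t ht => hw t (by simp [ht]))

theorem T_mem_Wd (hm : RowMono blk) (hP : IsDD blk PdV) {z : Z0 n} {σ : SgN n}
    (hσ : σ ∈ SgEta n blk) : T n (permZ0 n σ z) ∈ Wd blk PdV z Set.univ := by
  rw [← sact_T]
  refine sact_mem_Wd hm hP hσ ?_
  rw [← PdV_one hP (T n z)]
  exact PdV_mem_Wd (one_mem _) trivial

theorem etaFactB_inv_eq :
    (etaFactB n blk : KK n)⁻¹ =
      algebraMap (PolN n) (KK n) (MvPolynomial.C (etaFactB n blk : ℂ)⁻¹) := by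
  rw [← MvPolynomial.algebraMap_eq, ← IsScalarTower.algebraMap_apply ℂ (PolN n) (KK n), map_inv₀,
    map_natCast]

theorem etaFactB_ne_zero : (etaFactB n blk : KK n) ≠ 0 :=
  Nat.cast_ne_zero.2 Nat.card_pos.ne'

theorem symV_mem_Wd (hm : RowMono blk) (hP : IsDD blk PdV) {z : Z0 n} {x : VK n}
    (hx : x ∈ Wd blk PdV z Set.univ) : symV n blk x ∈ Wd blk PdV z Set.univ := by
  rw [symV, etaFactB_inv_eq]
  exact pspan_smul _ (sum_mem fun τ _ => sact_mem_Wd hm hP τ.2 hx)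

theorem symV_sub (x : VK n) :
    haveI : Fintype ↥(SgEta n blk) := Fintype.ofFinite _
    symV n blk x - x =
      (etaFactB n blk : KK n)⁻¹ • ∑ τ : ↥(SgEta n blk), (sact n (τ : SgN n) x - x) := by
  let _ : Fintype ↥(SgEta n blk) := Fintype.ofFinite _
  rw [Finset.sum_sub_distrib, smul_sub, Finset.sum_const, Finset.card_univ,
    ← Nat.card_eq_fintype_card, ← etaFactB, ← Nat.cast_smul_eq_nsmul (KK n),
    inv_smul_smul₀ etaFactB_ne_zero]
  rfl

/-- The span of the `p • PdV σ (T z)` with `p(v) = 0` and `σ ∈ S_η` of length at least `m`. -/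
def Vanish (blk : IdxN n → ℕ) (PdV : SgN n → VK n → VK n) (v : IdxN n → ℂ) (z : Z0 n) (m : ℕ) :
    Submodule ↥(Palg n) (VK n) :=
  pspan {x | ∃ p : PolN n, MvPolynomial.eval v p = 0 ∧ ∃ σ ∈ SgEta n blk,
    m ≤ len n (mEta n) σ ∧ x = algebraMap (PolN n) (KK n) p • PdV σ (T n z)}

section Vanish
variable {v : IdxN n → ℂ}

theorem smul_mem_Vanish {p : PolN n} (hp : MvPolynomial.eval v p = 0) {σ : SgN n}
    (hσ : σ ∈ SgEta n blk) {m : ℕ} (h : m ≤ len n (mEta n) σ) (z : Z0 n) :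
    algebraMap (PolN n) (KK n) p • PdV σ (T n z) ∈ Vanish blk PdV v z m :=
  Submodule.subset_span ⟨p, hp, σ, hσ, h, rfl⟩

theorem eval_rootP (hv : ∀ (k : Fin n) (i j : Fin ((k : ℕ) + 1)),
      blk ⟨k, i⟩ = blk ⟨k, j⟩ → v ⟨k, i⟩ = v ⟨k, j⟩)
    {s : SimpleDat n (mEta n)} (hs : LetBlk blk s) : MvPolynomial.eval v (rootP s) = 0 := by
  rw [rootP, map_sub, MvPolynomial.eval_X, MvPolynomial.eval_X, hv _ _ _ hs, sub_self]

theorem rootK_smul_ddL_mem_Vanish (hm : RowMono blk) (hP : IsDD blk PdV)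
    (hv : ∀ (k : Fin n) (i j : Fin ((k : ℕ) + 1)),
      blk ⟨k, i⟩ = blk ⟨k, j⟩ → v ⟨k, i⟩ = v ⟨k, j⟩)
    {s : SimpleDat n (mEta n)} (hs : LetBlk blk s) {σ : SgN n} (hσ : σ ∈ SgEta n blk) (z : Z0 n) :
    rootK s • ddL s (PdV σ (T n z)) ∈ Vanish blk PdV v z (len n (mEta n) σ + 1) := by
  rcases ddL_PdV hm hP hσ hs (T n z) with ⟨hl, he⟩ | he
  · rw [he]
    exact smul_mem_Vanish (eval_rootP hv hs) (mul_mem (sT_mem hs) hσ) hl.ge z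
  · rw [he, smul_zero]; exact zero_mem _

theorem Vanish_anti {z : Z0 n} {m m' : ℕ} (h : m ≤ m') :
    Vanish blk PdV v z m' ≤ Vanish blk PdV v z m :=
  Submodule.span_mono fun _ ⟨p, hp, σ, hσ, hl, hx⟩ => ⟨p, hp, σ, hσ, h.trans hl, hx⟩

theorem sact_sT_mem_Vanish (hm : RowMono blk) (hP : IsDD blk PdV)
    (hv : ∀ (k : Fin n) (i j : Fin ((k : ℕ) + 1)),
      blk ⟨k, i⟩ = blk ⟨k, j⟩ → v ⟨k, i⟩ = v ⟨k, j⟩)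
    {s : SimpleDat n (mEta n)} (hs : LetBlk blk s) {z : Z0 n} {m : ℕ} {x : VK n}
    (hx : x ∈ Vanish blk PdV v z m) : sact n (sT s) x ∈ Vanish blk PdV v z m := by
  refine pspan_induction (Q := fun x => sact n (sT s) x ∈ Vanish blk PdV v z m) ?_ ?_ ?_ ?_ hx
  · rintro _ ⟨p, hp, σ, hσ, hl, rfl⟩
    rw [sact_smul, actF_algebraMap, sact_eq_sub, smul_sub]
    refine sub_mem (smul_mem_Vanish ?_ hσ hl z) (pspan_smul _ (Vanish_anti (by omega)
      (rootK_smul_ddL_mem_Vanish hm hP hv hs hσ z)))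
    rw [eval_actP hv (sT_mem hs), hp]
  · rw [sact_zero]; exact zero_mem _
  · intro x y hx hy
    rw [sact_add]; exact add_mem hx hy
  · intro p x _ ih
    rw [sact_smul, actF_algebraMap]
    exact pspan_smul _ ih

theorem sact_PdV_sub_mem_Vanish (hm : RowMono blk) (hP : IsDD blk PdV)
    (hv : ∀ (k : Fin n) (i j : Fin ((k : ℕ) + 1)),
      blk ⟨k, i⟩ = blk ⟨k, j⟩ → v ⟨k, i⟩ = v ⟨k, j⟩)
    {τ : SgN n} (hτ : τ ∈ SgEta n blk) {σ : SgN n} (hσ : σ ∈ SgEta n blk) (z : Z0 n) :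
    sact n τ (PdV σ (T n z)) - PdV σ (T n z) ∈ Vanish blk PdV v z (len n (mEta n) σ + 1) := by
  obtain ⟨w, ⟨rfl, -⟩, hw⟩ := exists_isRedB hm hτ
  clear hτ
  induction w with
  | nil => rw [show wordPerm n (mEta n) [] = 1 from rfl, sact_one, sub_self]; exact zero_mem _
  | cons s w ih =>
    have hs := hw s (by simp)
    have h1 := sact_sT_mem_Vanish hm hP hv hs (ih fun t ht => hw t (by simp [ht]))
    have h2 := rootK_smul_ddL_mem_Vanish hm hP hv hs hσ z
    rw [sact_sub, sact_eq_sub s (PdV σ (T n z))] at h1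
    have h3 := sub_mem h1 h2
    rw [wordPerm_cons, sact_mul]
    rwa [sub_sub, sub_add_cancel] at h3

theorem symV_PdV_sub_mem_Vanish (hm : RowMono blk) (hP : IsDD blk PdV)
    (hv : ∀ (k : Fin n) (i j : Fin ((k : ℕ) + 1)),
      blk ⟨k, i⟩ = blk ⟨k, j⟩ → v ⟨k, i⟩ = v ⟨k, j⟩)
    {σ : SgN n} (hσ : σ ∈ SgEta n blk) (z : Z0 n) :
    symV n blk (PdV σ (T n z)) - PdV σ (T n z) ∈
      Vanish blk PdV v z (len n (mEta n) σ + 1) := by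
  rw [symV_sub, etaFactB_inv_eq]
  exact pspan_smul _ (sum_mem fun τ _ => sact_PdV_sub_mem_Vanish hm hP hv τ.2 hσ z)

end Vanish

/-- Divided differences of `p • T z`, up to terms of smaller length. -/
theorem ddWordV_smul_T (hm : RowMono blk) (hP : IsDD blk PdV) {w : Word n (mEta n)}
    (hw : WordBlk n blk w) (p : PolN n) (z : Z0 n) :
    ddWordV n w (algebraMap (PolN n) (KK n) p • T n z) -
      algebraMap (PolN n) (KK n) (actP n (mEta n) (wordPerm n (mEta n) w) p) •
        ddWordV n w (T n z) ∈ Wd blk PdV z {l | l < w.length} := by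
  induction w with
  | nil =>
    rw [show wordPerm n (mEta n) [] = 1 from rfl, actP_one]
    change algebraMap (PolN n) (KK n) p • T n z - algebraMap (PolN n) (KK n) p • T n z ∈ _
    rw [sub_self]; exact zero_mem _
  | cons s w ih =>
    have hw' : WordBlk n blk w := fun t ht => hw t (by simp [ht])
    have h1 : ddL s _ ∈ Wd blk PdV z {l | l < (s :: w).length} :=
      ddL_mem_Wd hm hP (fun l (hl : l < w.length) => hl.trans (Nat.lt_succ_self _))
        (fun l (hl : l < w.length) => Nat.succ_lt_succ hl) (hw s (by simp)) (ih hw')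
    rw [ddL_sub, ddL_smul, ← actP_mul, ← wordPerm_cons, ← ddWordV_cons, ← ddWordV_cons] at h1
    set q := ddP s (actP n (mEta n) (wordPerm n (mEta n) w) p)
    have h2 : algebraMap (PolN n) (KK n) q • ddWordV n w (T n z) ∈
        Wd blk PdV z {l | l < (s :: w).length} := by
      rcases ddWordV_eq hm hP hw' (T n z) with h0 | ⟨σ, hσ, hl, h⟩
      · rw [h0, smul_zero]; exact zero_mem _
      · rw [h]
        exact pspan_smul _ (PdV_mem_Wd hσ (by rw [hl]; exact Nat.lt_succ_self _))
    have h3 := add_mem h1 h2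
    rwa [← sub_sub, sub_right_comm, sub_add_cancel] at h3

theorem copN_PdV_sub_mem_Wd (hm : RowMono blk) (hP : IsDD blk PdV) {γ : PolN n}
    (hγ : ∀ σ : SgN n, actP n (mEta n) σ γ = γ) {σ : SgN n} (hσ : σ ∈ SgEta n blk) (z : Z0 n) :
    copN n γ (PdV σ (T n z)) -
      algebraMap (PolN n) (KK n) (actP n (mEta n) σ (shiftP n (z : IdxN n → ℤ) γ)) •
        PdV σ (T n z) ∈ Wd blk PdV z {l | l < len n (mEta n) σ} := by
  obtain ⟨w, hw⟩ := exists_isRedB hm hσ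
  have := ddWordV_smul_T hm hP hw.2 (shiftP n (z : IdxN n → ℤ) γ) z
  rw [hw.1.1, hw.1.2] at this
  rwa [hP σ hσ w hw, copN_ddWordV hγ, copN_T, shiftK_algebraMap]

/-! ### The lattice `L_η` and its fibre at `v` -/

/-- The `B_η`-module `L_η`. -/
def Leta (blk : IdxN n → ℕ) (PdV : SgN n → VK n → VK n) : Submodule ↥(Balg n blk) (VK n) :=
  Submodule.span ↥(Balg n blk)
    {x : VK n | ∃ σ ∈ SgEta n blk, ∃ z : Z0 n, x = symV n blk (PdV σ (T n z))}

/-- The submodule `(ker π_v) L_η`. -/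
def piSub (PdV : SgN n → VK n → VK n) (πv : ↥(Balg n blk) →ₐ[ℂ] ℂ) :
    Submodule ↥(Balg n blk) (VK n) :=
  Submodule.span ↥(Balg n blk)
    {x : VK n | ∃ f : ↥(Balg n blk), ∃ w ∈ Leta blk PdV, πv f = 0 ∧ x = (f : KK n) • w}

theorem algebraMap_mem_Balg (p : PolN n) : algebraMap (PolN n) (KK n) p ∈ Balg n blk :=
  ⟨p, 1, one_mem _, by rw [map_one, mul_one]⟩

theorem algebraMap_complex (a : ℂ) :
    algebraMap ℂ (KK n) a = algebraMap (PolN n) (KK n) (MvPolynomial.C a) := by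
  rw [← MvPolynomial.algebraMap_eq, ← IsScalarTower.algebraMap_apply ℂ (PolN n) (KK n)]

theorem algebraMap_smul_mem {M : Submodule ↥(Balg n blk) (VK n)} (p : PolN n) {x : VK n}
    (hx : x ∈ M) : algebraMap (PolN n) (KK n) p • x ∈ M :=
  M.smul_mem (⟨_, algebraMap_mem_Balg p⟩ : ↥(Balg n blk)) hx

theorem complex_smul_mem {M : Submodule ↥(Balg n blk) (VK n)} (a : ℂ) {x : VK n}
    (hx : x ∈ M) : algebraMap ℂ (KK n) a • x ∈ M := by
  rw [algebraMap_complex]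
  exact algebraMap_smul_mem _ hx

theorem mem_of_mem_pspan {S : Set (VK n)} {M : Submodule ↥(Balg n blk) (VK n)}
    (h : ∀ x ∈ S, x ∈ M) {x : VK n} (hx : x ∈ pspan S) : x ∈ M :=
  pspan_induction (Q := fun x => x ∈ M) h (zero_mem _) (fun _ _ => add_mem)
    (fun p _ _ => algebraMap_smul_mem p) hx

theorem map_smul_Balg (A : Module.End (KK n) (VK n)) (f : ↥(Balg n blk)) (x : VK n) :
    A (f • x) = f • A x :=
  A.map_smul (f : KK n) x

/-- `v` is constant along the `η`-blocks of each row. -/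
def RowConst (blk : IdxN n → ℕ) (v : IdxN n → ℂ) : Prop :=
  ∀ (k : Fin n) (i j : Fin ((k : ℕ) + 1)), blk ⟨k, i⟩ = blk ⟨k, j⟩ → v ⟨k, i⟩ = v ⟨k, j⟩

/-- `πv` restricts to the evaluation of polynomials at `v`. -/
def IsEval (πv : ↥(Balg n blk) →ₐ[ℂ] ℂ) (v : IdxN n → ℂ) : Prop :=
  ∀ (p : PolN n) (hp : algebraMap (PolN n) (KK n) p ∈ Balg n blk),
    πv ⟨algebraMap (PolN n) (KK n) p, hp⟩ = MvPolynomial.eval v p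

variable {v : IdxN n → ℂ} {πv : ↥(Balg n blk) →ₐ[ℂ] ℂ}

theorem PdV_mem_Leta (hm : RowMono blk) (hP : IsDD blk PdV)
    (hv : RowConst blk v)
    {σ : SgN n} (hσ : σ ∈ SgEta n blk) (z : Z0 n) : PdV σ (T n z) ∈ Leta blk PdV := by
  obtain ⟨L, hL⟩ := (Set.finite_range (len n (mEta n))).bddAbove
  have key : ∀ d : ℕ, ∀ σ ∈ SgEta n blk, L < len n (mEta n) σ + d →
      PdV σ (T n z) ∈ Leta blk PdV := by
    intro d
    induction d with
    | zero => exact fun σ _ h => absurd (hL ⟨σ, rfl⟩) (by omega)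
    | succ d ih =>
      intro σ hσ h
      have h1 : symV n blk (PdV σ (T n z)) ∈ Leta blk PdV :=
        Submodule.subset_span ⟨σ, hσ, z, rfl⟩
      have h2 : symV n blk (PdV σ (T n z)) - PdV σ (T n z) ∈ Leta blk PdV := by
        refine mem_of_mem_pspan ?_ (symV_PdV_sub_mem_Vanish hm hP hv hσ z)
        rintro _ ⟨p, -, ρ, hρ, hl, rfl⟩
        exact algebraMap_smul_mem _ (ih ρ hρ (by omega))
      have h3 := sub_mem h1 h2
      rwa [sub_sub_cancel] at h3
  exact key (L + 1) σ hσ (by omega)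

theorem mem_Leta_of_mem_Wd (hm : RowMono blk) (hP : IsDD blk PdV)
    (hv : RowConst blk v)
    {z : Z0 n} {S : Set ℕ} {x : VK n} (hx : x ∈ Wd blk PdV z S) : x ∈ Leta blk PdV := by
  refine mem_of_mem_pspan ?_ hx
  rintro _ ⟨σ, hσ, -, rfl⟩
  exact PdV_mem_Leta hm hP hv hσ z

/-- The derived tableaux before symmetrization. -/
def bvec (PdV : SgN n → VK n → VK n) (x : BIdx n blk) : VK n := PdV x.1.2 (T n x.1.1)

theorem Leta_eq_span (hm : RowMono blk) (hP : IsDD blk PdV)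
    (hv : RowConst blk v) :
    Leta blk PdV = Submodule.span ↥(Balg n blk) (Set.range (bvec (blk := blk) PdV)) := by
  refine le_antisymm (Submodule.span_le.2 ?_) (Submodule.span_le.2 ?_)
  · rintro _ ⟨σ, hσ, y, rfl⟩
    obtain ⟨z, hz, τ, hτ, rfl⟩ := exists_nset hm y
    obtain ⟨w, hw⟩ := exists_isRedB hm hσ
    refine mem_of_mem_pspan ?_ (symV_mem_Wd hm hP (z := z) ?_)
    · rintro _ ⟨ρ, hρ, -, rfl⟩
      by_cases h : IsShuffle n blk z ρ
      · exact Submodule.subset_span ⟨⟨(z, ρ), hz, h⟩, rfl⟩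
      · rw [PdV_eq_zero hm hP hz hρ h]; exact zero_mem _
    · rw [hP σ hσ w hw]
      exact ddWordV_mem_Wd hm hP hw.2 (T_mem_Wd hm hP hτ)
  · rintro _ ⟨x, rfl⟩
    exact PdV_mem_Leta hm hP hv x.2.2.1 _

theorem copN_mem_Leta (hm : RowMono blk) (hP : IsDD blk PdV)
    (hv : RowConst blk v)
    {γ : PolN n} (hγ : ∀ σ : SgN n, actP n (mEta n) σ γ = γ) {w : VK n}
    (hw : w ∈ Leta blk PdV) : copN n γ w ∈ Leta blk PdV := by
  have hw' := hw
  rw [Leta_eq_span hm hP hv] at hw'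
  refine Submodule.span_induction (p := fun w _ => copN n γ w ∈ Leta blk PdV) ?_ ?_ ?_ ?_ hw'
  · rintro _ ⟨x, rfl⟩
    have h1 := mem_Leta_of_mem_Wd hm hP hv (copN_PdV_sub_mem_Wd hm hP hγ x.2.2.1 x.1.1)
    have h2 := add_mem h1 (algebraMap_smul_mem
      (actP n (mEta n) x.1.2 (shiftP n (x.1.1 : IdxN n → ℤ) γ))
      (PdV_mem_Leta hm hP hv x.2.2.1 x.1.1))
    rw [sub_add_cancel] at h2
    exact h2
  · rw [map_zero]; exact zero_mem _
  · intro x y _ _ hx hy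
    rw [map_add]; exact add_mem hx hy
  · intro f x _ hx
    rw [map_smul_Balg]; exact Submodule.smul_mem _ f hx

theorem map_mem_piSub {A : Module.End (KK n) (VK n)}
    (hA : ∀ w ∈ Leta blk PdV, A w ∈ Leta blk PdV) {w : VK n} (hw : w ∈ piSub PdV πv) :
    A w ∈ piSub PdV πv := by
  refine Submodule.span_induction (p := fun w _ => A w ∈ piSub PdV πv) ?_ ?_ ?_ ?_ hw
  · rintro _ ⟨f, w, hw, hf, rfl⟩
    rw [LinearMap.map_smul]
    exact Submodule.subset_span ⟨f, A w, hA w hw, hf, rfl⟩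
  · rw [map_zero]; exact zero_mem _
  · intro x y _ _ hx hy
    rw [map_add]; exact add_mem hx hy
  · intro f x _ hx
    rw [map_smul_Balg]; exact Submodule.smul_mem _ f hx

theorem algebraMap_smul_mem_piSub (hπ : IsEval πv v) {p : PolN n}
    (hp : MvPolynomial.eval v p = 0) {x : VK n} (hx : x ∈ Leta blk PdV) :
    algebraMap (PolN n) (KK n) p • x ∈ piSub PdV πv :=
  Submodule.subset_span ⟨⟨_, algebraMap_mem_Balg p⟩, x, hx, by rw [hπ, hp], rfl⟩

theorem symV_PdV_sub_mem_piSub (hm : RowMono blk) (hP : IsDD blk PdV) (hv : RowConst blk v)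
    (hπ : IsEval πv v) {σ : SgN n} (hσ : σ ∈ SgEta n blk) (z : Z0 n) :
    symV n blk (PdV σ (T n z)) - PdV σ (T n z) ∈ piSub PdV πv := by
  refine mem_of_mem_pspan ?_ (symV_PdV_sub_mem_Vanish hm hP hv hσ z)
  rintro _ ⟨p, hp, ρ, hρ, -, rfl⟩
  exact algebraMap_smul_mem_piSub hπ hp (PdV_mem_Leta hm hP hv hρ z)

/-- The operator `c_γ - γ(v + z)`. -/
def nilN (v : IdxN n → ℂ) (z : Z0 n) (γ : PolN n) : Module.End (KK n) (VK n) :=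
  copN n γ - algebraMap ℂ (KK n) (evalVZ n v z γ) • 1

theorem nilN_apply (z : Z0 n) (γ : PolN n) (x : VK n) :
    nilN v z γ x = copN n γ x - algebraMap ℂ (KK n) (evalVZ n v z γ) • x := rfl

theorem nilN_mem_Leta (hm : RowMono blk) (hP : IsDD blk PdV) (hv : RowConst blk v) {γ : PolN n}
    (hγ : ∀ σ : SgN n, actP n (mEta n) σ γ = γ) (z : Z0 n) {w : VK n}
    (hw : w ∈ Leta blk PdV) : nilN v z γ w ∈ Leta blk PdV := by
  rw [nilN_apply]
  exact sub_mem (copN_mem_Leta hm hP hv hγ hw) (complex_smul_mem _ hw)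

theorem nilN_pow_mem_piSub (hm : RowMono blk) (hP : IsDD blk PdV) (hv : RowConst blk v)
    {γ : PolN n} (hγ : ∀ σ : SgN n, actP n (mEta n) σ γ = γ) (z : Z0 n) (m : ℕ) {w : VK n}
    (hw : w ∈ piSub PdV πv) : (nilN v z γ ^ m) w ∈ piSub PdV πv := by
  induction m with
  | zero => exact hw
  | succ m ih =>
    rw [pow_succ']
    exact map_mem_piSub (fun w hw => nilN_mem_Leta hm hP hv hγ z hw) ih

theorem nilN_PdV (hm : RowMono blk) (hP : IsDD blk PdV) (hv : RowConst blk v)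
    (hπ : IsEval πv v) {γ : PolN n} (hγ : ∀ σ : SgN n, actP n (mEta n) σ γ = γ) {σ : SgN n}
    (hσ : σ ∈ SgEta n blk) (z : Z0 n) :
    ∃ u ∈ Wd blk PdV z {l | l < len n (mEta n) σ}, ∃ w ∈ piSub PdV πv,
      nilN v z γ (PdV σ (T n z)) = u + w := by
  set q := actP n (mEta n) σ (shiftP n (z : IdxN n → ℤ) γ) with hq
  refine ⟨_, copN_PdV_sub_mem_Wd hm hP hγ hσ z,
    algebraMap (PolN n) (KK n) (q - MvPolynomial.C (evalVZ n v z γ)) • PdV σ (T n z), ?_, ?_⟩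
  · refine algebraMap_smul_mem_piSub hπ ?_ (PdV_mem_Leta hm hP hv hσ z)
    rw [map_sub, hq, eval_actP hv hσ, eval_shiftP, MvPolynomial.eval_C, sub_self]
  · rw [nilN_apply, algebraMap_complex, ← hq, map_sub, sub_smul, sub_add_sub_cancel]

theorem nilN_pow_mem_piSub_of_mem_Wd (hm : RowMono blk) (hP : IsDD blk PdV)
    (hv : RowConst blk v) (hπ : IsEval πv v) {γ : PolN n}
    (hγ : ∀ σ : SgN n, actP n (mEta n) σ γ = γ) (z : Z0 n) (m : ℕ) {u : VK n}
    (hu : u ∈ Wd blk PdV z {l | l < m}) : (nilN v z γ ^ m) u ∈ piSub PdV πv := by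
  induction m generalizing u with
  | zero =>
    refine mem_of_mem_pspan ?_ hu
    rintro _ ⟨σ, -, hl, -⟩
    exact absurd hl (Nat.not_lt_zero _)
  | succ m ih =>
    refine pspan_induction (Q := fun u => (nilN v z γ ^ (m + 1)) u ∈ piSub PdV πv) ?_ ?_ ?_ ?_ hu
    · rintro _ ⟨σ, hσ, hl, rfl⟩
      obtain ⟨u, hu, w, hw, h⟩ := nilN_PdV (πv := πv) hm hP hv hπ hγ hσ z
      rw [pow_succ, Module.End.mul_apply, h, map_add]
      refine add_mem (ih (Wd_mono ?_ hu)) (nilN_pow_mem_piSub hm hP hv hγ z m hw)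
      exact fun l hl' => lt_of_lt_of_le hl' (Nat.lt_succ_iff.1 hl)
    · rw [map_zero]; exact zero_mem _
    · intro x y hx hy
      rw [map_add]; exact add_mem hx hy
    · intro p x _ hx
      rw [LinearMap.map_smul]; exact algebraMap_smul_mem p hx

theorem nilN_pow_symV_mem_piSub (hm : RowMono blk) (hP : IsDD blk PdV)
    (hv : RowConst blk v) (hπ : IsEval πv v) {γ : PolN n}
    (hγ : ∀ σ : SgN n, actP n (mEta n) σ γ = γ) (z : Z0 n) {σ : SgN n}
    (hσ : σ ∈ SgEta n blk) {m : ℕ} (h : len n (mEta n) σ < m) :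
    (nilN v z γ ^ m) (symV n blk (PdV σ (T n z))) ∈ piSub PdV πv := by
  have h1 := nilN_pow_mem_piSub hm hP hv hγ z m (symV_PdV_sub_mem_piSub hm hP hv hπ hσ z)
  have h2 := nilN_pow_mem_piSub_of_mem_Wd hm hP hv hπ hγ z m
    (PdV_mem_Wd (S := {l | l < m}) hσ h)
  rw [map_sub] at h1
  have h3 := add_mem h1 h2
  rwa [sub_add_cancel] at h3

/-! ### Linear independence -/

theorem coeffV_ddL (y : Z0 n) (s : SimpleDat n (mEta n)) (x : VK n) :
    coeffV y (ddL s x) = (rootK s)⁻¹ *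
      (coeffV y x - actF n (mEta n) (sT s) (coeffV (permZ0 n (sT s) y) x)) := by
  rw [ddL_eq, LinearMap.map_smul, map_sub, coeffV_sact, simpleT_inv, smul_eq_mul]

theorem permZ0_sT_sT (s : SimpleDat n (mEta n)) (y : Z0 n) :
    permZ0 n (sT s) (permZ0 n (sT s) y) = y := by
  rw [← permZ0_mul, simpleT_mul_self, permZ0_one]

theorem len_sT_mul_le (s : SimpleDat n (mEta n)) (τ : SgN n) :
    len n (mEta n) (sT s * τ) ≤ len n (mEta n) τ + 1 := by
  rcases len_simpleT_mul τ s.1 s.2.1 s.2.2 with h | h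
  · exact h.le
  · exact (Nat.le_succ _).trans (h.le.trans (Nat.le_succ _))

theorem exists_of_coeffV_ddWordV_ne_zero {w : Word n (mEta n)} (hw : WordBlk n blk w) {y z : Z0 n}
    (h : coeffV y (ddWordV n w (T n z)) ≠ 0) :
    ∃ τ ∈ SgEta n blk, y = permZ0 n τ z ∧ len n (mEta n) τ ≤ w.length ∧
      (τ = wordPerm n (mEta n) w ∨ len n (mEta n) τ < w.length) := by
  classical
  induction w generalizing y with
  | nil =>
    have h' : coeffV y (T n z) ≠ 0 := h
    rw [coeffV_T] at h'
    refine ⟨1, one_mem _, ?_, by rw [len_one]; exact Nat.zero_le _, Or.inl rfl⟩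
    by_contra hne
    exact h' (if_neg fun he => hne he.symm)
  | cons s w ih =>
    have hw' : WordBlk n blk w := fun t ht => hw t (by simp [ht])
    rw [ddWordV_cons, coeffV_ddL] at h
    by_cases h0 : coeffV y (ddWordV n w (T n z)) = 0
    · have h1 : coeffV (permZ0 n (sT s) y) (ddWordV n w (T n z)) ≠ 0 := by
        intro h1
        exact h (by rw [h0, h1, map_zero, sub_zero, mul_zero])
      obtain ⟨τ, hτ, hy, hl, hd⟩ := ih hw' h1
      have hl' := len_sT_mul_le s τ
      refine ⟨sT s * τ, mul_mem (sT_mem (hw s (by simp))) hτ, ?_, ?_, ?_⟩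
      · rw [permZ0_mul, ← hy, permZ0_sT_sT]
      · rw [List.length_cons]; omega
      · rcases hd with rfl | hd
        · exact Or.inl (wordPerm_cons _ _).symm
        · right; rw [List.length_cons]; omega
    · obtain ⟨τ, hτ, hy, hl, -⟩ := ih hw' h0
      exact ⟨τ, hτ, hy, hl.trans (Nat.le_succ _), Or.inr (Nat.lt_succ_of_le hl)⟩

theorem coeffV_ddWordV_ne_zero {w : Word n (mEta n)} (hw : WordBlk n blk w) {z : Z0 n}
    (h : ∀ τ ∈ SgEta n blk, permZ0 n τ z = permZ0 n (wordPerm n (mEta n) w) z →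
      w.length ≤ len n (mEta n) τ) :
    coeffV (permZ0 n (wordPerm n (mEta n) w) z) (ddWordV n w (T n z)) ≠ 0 := by
  classical
  induction w with
  | nil =>
    change coeffV z (T n z) ≠ 0
    rw [coeffV_T, if_pos rfl]
    exact one_ne_zero
  | cons s w ih =>
    have hw' : WordBlk n blk w := fun t ht => hw t (by simp [ht])
    have h0 : coeffV (permZ0 n (wordPerm n (mEta n) (s :: w)) z) (ddWordV n w (T n z)) = 0 := by
      by_contra hne
      obtain ⟨τ, hτ, hy, hl, -⟩ := exists_of_coeffV_ddWordV_ne_zero hw' hne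
      have := h τ hτ hy.symm
      rw [List.length_cons] at this
      omega
    have h1 := ih hw' fun τ hτ he => by
      have := h (sT s * τ) (mul_mem (sT_mem (hw s (by simp))) hτ)
        (by rw [permZ0_mul, he, wordPerm_cons, permZ0_mul])
      rw [List.length_cons] at this
      exact Nat.le_of_succ_le_succ (this.trans (len_sT_mul_le s τ))
    rw [ddWordV_cons, coeffV_ddL, h0, wordPerm_cons, permZ0_mul, permZ0_sT_sT, zero_sub]
    exact mul_ne_zero (inv_ne_zero (rootK_ne_zero s))
      (neg_ne_zero.2 ((map_ne_zero_iff _ (RingEquiv.injective _)).2 h1))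

theorem linearIndependent_bvec (hm : RowMono blk) (hP : IsDD blk PdV) :
    LinearIndependent (KK n) (bvec (blk := blk) PdV) := by
  rw [linearIndependent_iff]
  intro l hl
  by_contra hne
  obtain ⟨x, hx, hmax⟩ := Finset.exists_max_image l.support
    (fun x => len n (mEta n) x.1.2) (Finsupp.support_nonempty_iff.2 hne)
  have h := congrArg (coeffV (permZ0 n x.1.2 x.1.1)) hl
  rw [Finsupp.linearCombination_apply, Finsupp.sum, map_sum, map_zero,
    Finset.sum_eq_single x] at h
  · rw [LinearMap.map_smul, smul_eq_mul] at h
    obtain ⟨w, hw⟩ := exists_isRedB hm x.2.2.1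
    rcases mul_eq_zero.1 h with h | h
    · exact Finsupp.mem_support_iff.1 hx h
    · rw [bvec, hP _ x.2.2.1 w hw] at h
      have h' := coeffV_ddWordV_ne_zero hw.2 (z := x.1.1) fun τ hτ he => by
        rw [hw.1.2]
        rw [hw.1.1] at he
        exact len_le_of_isShuffle hm x.2.1 x.2.2 hτ he
      rw [hw.1.1] at h'
      exact h' h
  · intro x' hx' hxx
    rw [LinearMap.map_smul, smul_eq_mul]
    refine mul_eq_zero_of_right _ ?_
    by_contra hc
    obtain ⟨w, hw⟩ := exists_isRedB hm x'.2.2.1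
    rw [bvec, hP _ x'.2.2.1 w hw] at hc
    obtain ⟨τ, hτ, hy, hl, hd⟩ := exists_of_coeffV_ddWordV_ne_zero hw.2 hc
    have hz : x'.1.1 = x.1.1 := by
      refine nset_unique hm x.2.1 x'.2.1 (mul_mem (inv_mem x.2.2.1) hτ) ?_
      rw [permZ0_mul, ← hy, ← permZ0_mul, inv_mul_cancel, permZ0_one]
    have hmax' := hmax x' hx'
    have hle := len_le_of_isShuffle hm x.2.1 x.2.2 hτ (by rw [hy, hz])
    rw [hw.1.2] at hl hd
    have hτ' : τ = x'.1.2 := by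
      rcases hd with hd | hd
      · rw [hd, hw.1.1]
      · omega
    have hs : IsShuffle n blk x.1.1 x'.1.2 := hz ▸ x'.2.2
    have hσ : x'.1.2 = x.1.2 :=
      isShuffle_unique hm x.2.1 hs x.2.2 (by rw [hy, hz, hτ'])
    exact hxx (Subtype.ext (Prod.ext hz hσ))
  · exact fun h => absurd hx h

theorem linearIndependent_bvec_Balg (hm : RowMono blk) (hP : IsDD blk PdV) :
    LinearIndependent ↥(Balg n blk) (bvec (blk := blk) PdV) := by
  refine (linearIndependent_bvec hm hP).restrict_scalars ?_
  intro a b h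
  have h' : (a : KK n) * 1 = (b : KK n) * 1 := h
  rw [mul_one, mul_one] at h'
  exact Subtype.ext h'

/-! ### The basis of the fibre and its generalized weight spaces -/

theorem smul_mem_piSub {f : ↥(Balg n blk)} (hf : πv f = 0) {w : VK n} (hw : w ∈ Leta blk PdV) :
    f • w ∈ piSub PdV πv :=
  Submodule.subset_span ⟨f, w, hw, hf, rfl⟩

theorem sum_sub_sum_mem {ι : Type*} {M : Submodule ↥(Balg n blk) (VK n)} (c : ι →₀ ℂ)
    {u u' : ι → VK n} (h : ∀ i, u i - u' i ∈ M) :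
    (c.sum fun i a => algebraMap ℂ (KK n) a • u i) -
      (c.sum fun i a => algebraMap ℂ (KK n) a • u' i) ∈ M := by
  rw [← Finsupp.sum_sub]
  refine sum_mem fun i _ => ?_
  beta_reduce
  rw [← smul_sub]
  exact complex_smul_mem _ (h i)

theorem exists_of_mem_Leta (hm : RowMono blk) (hP : IsDD blk PdV) (hv : RowConst blk v)
    {w : VK n} (hw : w ∈ Leta blk PdV) :
    ∃ f : BIdx n blk →₀ ↥(Balg n blk),
      Finsupp.linearCombination ↥(Balg n blk) (bvec PdV) f = w := by
  rw [Leta_eq_span hm hP hv] at hw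
  exact (Finsupp.mem_span_range_iff_exists_finsupp).1 hw

theorem exists_of_mem_piSub (hm : RowMono blk) (hP : IsDD blk PdV) (hv : RowConst blk v)
    {w : VK n} (hw : w ∈ piSub PdV πv) :
    ∃ f : BIdx n blk →₀ ↥(Balg n blk), (∀ x, πv (f x) = 0) ∧
      Finsupp.linearCombination ↥(Balg n blk) (bvec PdV) f = w := by
  refine Submodule.span_induction (p := fun w _ => ∃ f : BIdx n blk →₀ ↥(Balg n blk),
    (∀ x, πv (f x) = 0) ∧ Finsupp.linearCombination ↥(Balg n blk) (bvec PdV) f = w)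
    ?_ ?_ ?_ ?_ hw
  · rintro _ ⟨f, w, hw, hf, rfl⟩
    obtain ⟨g, rfl⟩ := exists_of_mem_Leta hm hP hv hw
    refine ⟨f • g, fun x => ?_, map_smul _ f g⟩
    rw [Finsupp.smul_apply, smul_eq_mul, map_mul, hf, zero_mul]
  · exact ⟨0, fun x => map_zero πv, map_zero _⟩
  · rintro _ _ _ _ ⟨f, hf, rfl⟩ ⟨g, hg, rfl⟩
    refine ⟨f + g, fun x => ?_, map_add _ f g⟩
    rw [Finsupp.add_apply, map_add, hf, hg, add_zero]
  · rintro a _ _ ⟨f, hf, rfl⟩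
    refine ⟨a • f, fun x => ?_, map_smul _ a f⟩
    rw [Finsupp.smul_apply, smul_eq_mul, map_mul, hf, mul_zero]

/-- The derived tableaux. -/
def dvec (PdV : SgN n → VK n → VK n) (x : BIdx n blk) : VK n :=
  symV n blk (PdV x.1.2 (T n x.1.1))

theorem dvec_sub_bvec_mem_piSub (hm : RowMono blk) (hP : IsDD blk PdV) (hv : RowConst blk v)
    (hπ : IsEval πv v) (x : BIdx n blk) : dvec PdV x - bvec PdV x ∈ piSub PdV πv :=
  symV_PdV_sub_mem_piSub hm hP hv hπ x.2.2.1 x.1.1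

theorem linearCombination_mapRange {ι : Type*} (c : ι →₀ ℂ) (u : ι → VK n) :
    Finsupp.linearCombination ↥(Balg n blk) u
      (c.mapRange (algebraMap ℂ ↥(Balg n blk)) (map_zero _)) =
      c.sum fun i a => algebraMap ℂ (KK n) a • u i := by
  rw [Finsupp.linearCombination_apply,
    Finsupp.sum_mapRange_index fun i => zero_smul ↥(Balg n blk) (u i)]
  rfl

theorem eq_zero_of_sum_mem_piSub (hm : RowMono blk) (hP : IsDD blk PdV) (hv : RowConst blk v)
    (hπ : IsEval πv v) (c : BIdx n blk →₀ ℂ)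
    (h : (c.sum fun x a => algebraMap ℂ (KK n) a • dvec PdV x) ∈ piSub PdV πv) : c = 0 := by
  have h2 := sub_mem h (sum_sub_sum_mem c (dvec_sub_bvec_mem_piSub hm hP hv hπ))
  rw [sub_sub_cancel] at h2
  obtain ⟨f, hf, he⟩ := exists_of_mem_piSub hm hP hv h2
  have hfg := linearIndependent_bvec_Balg hm hP (he.trans (linearCombination_mapRange c _).symm)
  ext x
  have := hf x
  rw [hfg, Finsupp.mapRange_apply, AlgHom.commutes] at this
  exact this

theorem exists_sub_sum_mem_piSub (hm : RowMono blk) (hP : IsDD blk PdV) (hv : RowConst blk v)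
    (hπ : IsEval πv v) {w : VK n} (hw : w ∈ Leta blk PdV) :
    ∃ c : BIdx n blk →₀ ℂ,
      w - (c.sum fun x a => algebraMap ℂ (KK n) a • dvec PdV x) ∈ piSub PdV πv := by
  obtain ⟨f, rfl⟩ := exists_of_mem_Leta hm hP hv hw
  refine ⟨f.mapRange πv (map_zero _), ?_⟩
  have h1 := sum_sub_sum_mem (f.mapRange πv (map_zero _)) (dvec_sub_bvec_mem_piSub hm hP hv hπ)
  rw [← sub_sub_sub_cancel_right]
  refine sub_mem ?_ h1
  rw [Finsupp.linearCombination_apply, Finsupp.sum_mapRange_index fun x => by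
    rw [map_zero, zero_smul], ← Finsupp.sum_sub]
  refine sum_mem fun x _ => ?_
  have hx : πv (f x - algebraMap ℂ ↥(Balg n blk) (πv (f x))) = 0 := by
    rw [map_sub, AlgHom.commutes]
    exact sub_self _
  have := smul_mem_piSub hx (PdV_mem_Leta hm hP hv x.2.2.1 x.1.1)
  rw [sub_smul] at this
  exact this

/-! ### Generalized weight spaces -/

theorem copN_comm (γ δ : PolN n) (x : VK n) :
    copN n γ (copN n δ x) = copN n δ (copN n γ x) := by
  refine vk_induction (P := fun x => copN n γ (copN n δ x) = copN n δ (copN n γ x)) ?_ ?_ ?_ x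
  · simp only [map_zero]
  · intro x y hx hy
    simp only [map_add, hx, hy]
  · intro f z
    simp only [LinearMap.map_smul, copN_T, smul_smul, mul_comm, mul_left_comm]

/-- `(ker π_v) L_η` as a complex subspace. -/
def piSubC (PdV : SgN n → VK n → VK n) (πv : ↥(Balg n blk) →ₐ[ℂ] ℂ) : Submodule ℂ (VK n) where
  carrier := piSub PdV πv
  add_mem' := (piSub PdV πv).add_mem
  zero_mem' := (piSub PdV πv).zero_mem
  smul_mem' a x hx := by
    rw [← algebraMap_smul (KK n) a x]
    exact complex_smul_mem a hx

theorem mkQ_eq_zero {x : VK n} : (piSubC PdV πv).mkQ x = 0 ↔ x ∈ piSub PdV πv :=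
  Submodule.Quotient.mk_eq_zero _

theorem copN_mem_piSub (hm : RowMono blk) (hP : IsDD blk PdV) (hv : RowConst blk v) {γ : PolN n}
    (hγ : ∀ σ : SgN n, actP n (mEta n) σ γ = γ) {w : VK n} (hw : w ∈ piSub PdV πv) :
    copN n γ w ∈ piSub PdV πv :=
  map_mem_piSub (fun _ hw => copN_mem_Leta hm hP hv hγ hw) hw

/-- The operator induced by `c_γ` on `V_K / (ker π_v) L_η`. -/
def copQ (PdV : SgN n → VK n → VK n) (πv : ↥(Balg n blk) →ₐ[ℂ] ℂ) (γ : PolN n)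
    (h : ∀ w ∈ piSub PdV πv, copN n γ w ∈ piSub PdV πv) :
    Module.End ℂ (VK n ⧸ piSubC PdV πv) :=
  (piSubC PdV πv).mapQ (piSubC PdV πv) ((copN n γ).restrictScalars ℂ) h

theorem copQ_mkQ {γ : PolN n} (h : ∀ w ∈ piSub PdV πv, copN n γ w ∈ piSub PdV πv) (x : VK n) :
    copQ PdV πv γ h ((piSubC PdV πv).mkQ x) = (piSubC PdV πv).mkQ (copN n γ x) := rfl

theorem copQ_sub_pow_mkQ {γ : PolN n} (h : ∀ w ∈ piSub PdV πv, copN n γ w ∈ piSub PdV πv)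
    (z : Z0 n) (m : ℕ) (x : VK n) :
    ((copQ PdV πv γ h - evalVZ n v z γ • 1) ^ m) ((piSubC PdV πv).mkQ x) =
      (piSubC PdV πv).mkQ ((nilN v z γ ^ m) x) := by
  induction m with
  | zero => rfl
  | succ m ih =>
    rw [pow_succ', pow_succ', Module.End.mul_apply, ih, Module.End.mul_apply, nilN_apply,
      LinearMap.sub_apply, copQ_mkQ, algebraMap_smul, map_sub, map_smul]
    rfl

theorem commute_copQ {γ δ : PolN n} (h : ∀ w ∈ piSub PdV πv, copN n γ w ∈ piSub PdV πv)
    (h' : ∀ w ∈ piSub PdV πv, copN n δ w ∈ piSub PdV πv) :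
    Commute (copQ PdV πv γ h) (copQ PdV πv δ h') := by
  refine LinearMap.ext fun q => ?_
  obtain ⟨x, rfl⟩ := (piSubC PdV πv).mkQ_surjective q
  rw [Module.End.mul_apply, Module.End.mul_apply, copQ_mkQ, copQ_mkQ, copQ_mkQ, copQ_mkQ,
    copN_comm]

/-- The algebra of `S_μ`-invariant polynomials, as a type. -/
abbrev InvPol (n : ℕ) : Type := {γ : PolN n // ∀ σ : SgN n, actP n (mEta n) σ γ = γ}

/-- The joint generalized eigenspaces of the operators induced by the `c_γ`. -/
def wtSpace (h : ∀ γ : InvPol n, ∀ w ∈ piSub PdV πv, copN n γ w ∈ piSub PdV πv)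
    (χ : InvPol n → ℂ) : Submodule ℂ (VK n ⧸ piSubC PdV πv) :=
  ⨅ γ : InvPol n, (copQ PdV πv γ (h γ)).maxGenEigenspace (χ γ)

theorem iSupIndep_wtSpace (h : ∀ γ : InvPol n, ∀ w ∈ piSub PdV πv, copN n γ w ∈ piSub PdV πv) :
    iSupIndep (wtSpace h) :=
  Module.End.independent_iInf_maxGenEigenspace_of_forall_mapsTo _ fun γ δ a =>
    Module.End.mapsTo_maxGenEigenspace_of_comm (commute_copQ (h δ) (h γ)) a

theorem mkQ_mem_wtSpace (h : ∀ γ : InvPol n, ∀ w ∈ piSub PdV πv, copN n γ w ∈ piSub PdV πv)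
    {z : Z0 n} {x : VK n} :
    (piSubC PdV πv).mkQ x ∈ wtSpace h (fun γ => evalVZ n v z γ) ↔
      ∀ γ : InvPol n, ∃ m : ℕ, (nilN v z γ ^ m) x ∈ piSub PdV πv := by
  rw [wtSpace, Submodule.mem_iInf]
  refine forall_congr' fun γ => ?_
  rw [Module.End.mem_maxGenEigenspace]
  refine exists_congr fun m => ?_
  rw [copQ_sub_pow_mkQ, mkQ_eq_zero]

theorem mkQ_dvec_mem_wtSpace (hm : RowMono blk) (hP : IsDD blk PdV) (hv : RowConst blk v)
    (hπ : IsEval πv v)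
    (h : ∀ γ : InvPol n, ∀ w ∈ piSub PdV πv, copN n γ w ∈ piSub PdV πv) (x : BIdx n blk) :
    (piSubC PdV πv).mkQ (dvec PdV x) ∈ wtSpace h (fun γ => evalVZ n v x.1.1 γ) :=
  (mkQ_mem_wtSpace h).2 fun γ =>
    ⟨_, nilN_pow_symV_mem_piSub hm hP hv hπ γ.2 x.1.1 x.2.2.1 (Nat.lt_succ_self _)⟩

theorem mkQ_sum {ι : Type*} (c : ι →₀ ℂ) (u : ι → VK n) :
    (piSubC PdV πv).mkQ (c.sum fun i a => algebraMap ℂ (KK n) a • u i) =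
      c.sum fun i a => a • (piSubC PdV πv).mkQ (u i) := by
  rw [Finsupp.sum, map_sum]
  refine Finset.sum_congr rfl fun i _ => ?_
  rw [algebraMap_smul, map_smul]

theorem of_mem_support_filter {ι : Type*} {p : ι → Prop} [DecidablePred p] {c : ι →₀ ℂ} {x : ι}
    (h : x ∈ (c.filter p).support) : p x := by
  rw [Finsupp.support_filter] at h
  exact (Finset.mem_filter.1 h).2

theorem exists_sub_sum_mem_piSub_of_mem_wtSpace (hm : RowMono blk) (hP : IsDD blk PdV)
    (hv : RowConst blk v) (hπ : IsEval πv v)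
    (hinj : ∀ y ∈ Nset n blk, ∀ z ∈ Nset n blk,
      (∀ γ : InvPol n, evalVZ n v y γ = evalVZ n v z γ) → y = z)
    (h : ∀ γ : InvPol n, ∀ w ∈ piSub PdV πv, copN n γ w ∈ piSub PdV πv)
    {z : Z0 n} (hz : z ∈ Nset n blk) {w : VK n} (hw : w ∈ Leta blk PdV)
    (hwz : (piSubC PdV πv).mkQ w ∈ wtSpace h (fun γ => evalVZ n v z γ)) :
    ∃ c : {σ : SgN n // IsShuffle n blk z σ} →₀ ℂ,
      w - (c.sum fun σ a => algebraMap ℂ (KK n) a • symV n blk (PdV σ.1 (T n z))) ∈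
        piSub PdV πv := by
  classical
  obtain ⟨c, hc⟩ := exists_sub_sum_mem_piSub hm hP hv hπ hw
  let e : {σ : SgN n // IsShuffle n blk z σ} → BIdx n blk := fun σ => ⟨(z, σ.1), hz, σ.2⟩
  have he : Function.Injective e := fun σ τ hστ =>
    Subtype.ext (congrArg (fun x : BIdx n blk => x.1.2) hστ)
  let c₁ := c.filter fun x => x.1.1 = z
  let c₂ := c.filter fun x => ¬ x.1.1 = z
  have hadd : c₁ + c₂ = c := Finsupp.filter_add_filter_not c _
  have hcomap : ((c₁.comapDomain e he.injOn).sum fun σ a =>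
      algebraMap ℂ (KK n) a • symV n blk (PdV σ.1 (T n z))) =
      c₁.sum fun x a => algebraMap ℂ (KK n) a • dvec PdV x := by
    refine Finsupp.sum_comapDomain e c₁
      (fun x a => algebraMap ℂ (KK n) a • dvec PdV x) ⟨fun _ hx => hx, he.injOn, ?_⟩
    intro x hx
    have hxz := of_mem_support_filter (p := fun x : BIdx n blk => x.1.1 = z) hx
    have hex : e ⟨x.1.2, hxz ▸ x.2.2⟩ = x := Subtype.ext (Prod.ext hxz.symm rfl)
    exact ⟨_, by rwa [Set.mem_preimage, hex], hex⟩
  refine ⟨c₁.comapDomain e he.injOn, ?_⟩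
  rw [hcomap]
  have hsum : (c.sum fun x a => algebraMap ℂ (KK n) a • dvec PdV x) =
      (c₁.sum fun x a => algebraMap ℂ (KK n) a • dvec PdV x) +
        c₂.sum fun x a => algebraMap ℂ (KK n) a • dvec PdV x := by
    rw [← hadd]
    exact Finsupp.sum_add_index' (fun x => by rw [map_zero, zero_smul])
      fun x a b => by rw [map_add, add_smul]
  rw [hsum, ← sub_sub, ← mkQ_eq_zero, map_sub, sub_eq_zero] at hc
  rw [← mkQ_eq_zero]
  have hd := iSupIndep_wtSpace h (fun γ => evalVZ n v z γ)
  refine Submodule.disjoint_def.1 hd _ ?_ ?_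
  · rw [map_sub]
    refine sub_mem hwz ?_
    rw [mkQ_sum]
    refine sum_mem fun x hx => Submodule.smul_mem _ _ ?_
    have hxz := of_mem_support_filter (p := fun x : BIdx n blk => x.1.1 = z) hx
    rw [← hxz]
    exact mkQ_dvec_mem_wtSpace hm hP hv hπ h x
  · rw [hc, mkQ_sum]
    refine sum_mem fun x hx => Submodule.smul_mem _ _ ?_
    have hxz := of_mem_support_filter (p := fun x : BIdx n blk => ¬ x.1.1 = z) hx
    have hχ : (fun γ : InvPol n => evalVZ n v x.1.1 γ) ≠ fun γ : InvPol n => evalVZ n v z γ :=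
      fun heq => hxz (hinj _ x.2.1 _ hz fun γ => congrFun heq γ)
    exact Submodule.mem_iSup_of_mem _
      (Submodule.mem_iSup_of_mem hχ (mkQ_dvec_mem_wtSpace hm hP hv hπ h x))

theorem nilN_pow_mem_piSub_of_sub_sum (hm : RowMono blk) (hP : IsDD blk PdV)
    (hv : RowConst blk v) (hπ : IsEval πv v) {γ : PolN n}
    (hγ : ∀ σ : SgN n, actP n (mEta n) σ γ = γ) {z : Z0 n} {w : VK n}
    (c : {σ : SgN n // IsShuffle n blk z σ} →₀ ℂ)
    (hw : w - (c.sum fun σ a => algebraMap ℂ (KK n) a • symV n blk (PdV σ.1 (T n z))) ∈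
        piSub PdV πv) :
    ∃ m : ℕ, (nilN v z γ ^ m) w ∈ piSub PdV πv := by
  obtain ⟨L, hL⟩ := (Set.finite_range (len n (mEta n))).bddAbove
  refine ⟨L + 1, ?_⟩
  have h1 := nilN_pow_mem_piSub hm hP hv hγ z (L + 1) hw
  rw [map_sub] at h1
  rw [← sub_add_cancel ((nilN v z γ ^ (L + 1)) w)]
  refine add_mem h1 ?_
  rw [Finsupp.sum, map_sum]
  refine sum_mem fun σ _ => ?_
  rw [LinearMap.map_smul]
  exact complex_smul_mem _ (nilN_pow_symV_mem_piSub hm hP hv hπ hγ z σ.2.1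
    (Nat.lt_succ_of_le (hL ⟨σ.1, rfl⟩)))

end DerivedTableaux

/-- for v fully critical with singularity η, each operator c_γ
(γ ∈ ℂ[X_μ]^{S_μ}) preserves L_η, hence acts on V(T(v)) = ℂ_v ⊗_{B_η} L_η = L_η/M_v,
where M_v = (ker π_v)·L_η; the images 𝒟_σ^η(v+z) (z ∈ N_η, σ ∈ Shuffle^η_{ε(z)}) form a
ℂ-basis of V(T(v)); (i) (c_γ − γ(v+z))^{ℓ(σ)+1} kills 𝒟_σ^η(v+z); (ii) V(T(v)) is the
direct sum of the subspaces V_z spanned by the 𝒟_σ^η(v+z) (σ a shuffle), and V_z is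
exactly the joint generalized eigenspace of the c_γ with character γ ↦ γ(v+z); (iii)
dim_ℂ V_z = η!/ε(z)! (expressed as: the shuffles for z are independent modulo M_v and
their number times #S_{ε(z)} = #Stab_{S_η}(z) equals η! = #S_η).  In particular V(T(v))
is a Gelfand–Tsetlin module with support {χ_{v+z} : z ∈ N_η}, the multiplicity of
χ_{v+z} being η!/ε(z)!. -/
theorem statement18 (n : ℕ) (blk : IdxN n → ℕ)
    (hmono : ∀ k : Fin n, Monotone fun i : Fin ((k : ℕ) + 1) => blk ⟨k, i⟩)
    (htop : ∀ (k : Fin n) (i j : Fin ((k : ℕ) + 1)), (k : ℕ) + 1 = n →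
      blk ⟨k, i⟩ = blk ⟨k, j⟩ → i = j)
    (PdV : SgN n → VK n → VK n)
    (hPdV : ∀ σ ∈ SgEta n blk, ∀ w : Word n (mEta n), IsRedB n blk σ w →
      ∀ x : VK n, PdV σ x = ddWordV n w x)
    (v : IdxN n → ℂ)
    (hcrit1 : ∀ (k : Fin n) (i j : Fin ((k : ℕ) + 1)), (k : ℕ) + 1 < n →
      ((∃ c : ℤ, v ⟨k, i⟩ - v ⟨k, j⟩ = (c : ℂ)) ↔ blk ⟨k, i⟩ = blk ⟨k, j⟩))
    (hcrit2 : ∀ (k : Fin n) (i j : Fin ((k : ℕ) + 1)),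
      blk ⟨k, i⟩ = blk ⟨k, j⟩ → v ⟨k, i⟩ = v ⟨k, j⟩)
    (πv : ↥(Balg n blk) →ₐ[ℂ] ℂ)
    (hπv : ∀ (p : PolN n) (hp : algebraMap (PolN n) (KK n) p ∈ Balg n blk),
      πv ⟨algebraMap (PolN n) (KK n) p, hp⟩ = MvPolynomial.eval v p) :
    let Lη : Submodule ↥(Balg n blk) (VK n) := Submodule.span ↥(Balg n blk)
      {x : VK n | ∃ σ ∈ SgEta n blk, ∃ z : Z0 n, x = symV n blk (PdV σ (T n z))};
    let Mv : Submodule ↥(Balg n blk) (VK n) := Submodule.span ↥(Balg n blk)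
      {x : VK n | ∃ f : ↥(Balg n blk), ∃ w ∈ Lη, πv f = 0 ∧ x = (f : KK n) • w};
    -- each c_γ preserves L_η and M_v, hence induces a ℂ-linear operator on
    -- V(T(v)) = ℂ_v ⊗_{B_η} L_η = L_η / M_v
    (∀ γ : PolN n, (∀ σ : SgN n, actP n (mEta n) σ γ = γ) →
      (∀ w ∈ Lη, copN n γ w ∈ Lη) ∧ (∀ w ∈ Mv, copN n γ w ∈ Mv)) ∧
    -- (i) (c_γ − γ(v+z))^{ℓ(σ)+1} 𝒟_σ^η(v+z) = 0 in V(T(v))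
    (∀ γ : PolN n, (∀ σ : SgN n, actP n (mEta n) σ γ = γ) →
      ∀ z ∈ Nset n blk, ∀ σ : SgN n, IsShuffle n blk z σ →
        ((copN n γ - algebraMap ℂ (KK n) (evalVZ n v z γ) • 1) ^ (len n (mEta n) σ + 1))
            (symV n blk (PdV σ (T n z))) ∈ Mv) ∧
    -- the 𝒟_σ^η(v+z), z ∈ N_η, σ ∈ Shuffle^η_{ε(z)}, are ℂ-linearly independent in
    -- V(T(v))…
    (∀ c : BIdx n blk →₀ ℂ,
      (c.sum fun x a => algebraMap ℂ (KK n) a • symV n blk (PdV x.1.2 (T n x.1.1))) ∈ Mv →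
      c = 0) ∧
    -- …and they span V(T(v)); together with the previous item, they form a ℂ-basis and
    -- V(T(v)) = ⊕_{z ∈ N_η} V_z
    (∀ w ∈ Lη, ∃ c : BIdx n blk →₀ ℂ,
      w - (c.sum fun x a => algebraMap ℂ (KK n) a • symV n blk (PdV x.1.2 (T n x.1.1)))
        ∈ Mv) ∧
    -- (ii) V_z is exactly the joint generalized eigenspace of the c_γ with eigenvalue
    -- character γ ↦ γ(v+z)
    (∀ z ∈ Nset n blk, ∀ w ∈ Lη,
      ((∀ γ : PolN n, (∀ σ : SgN n, actP n (mEta n) σ γ = γ) →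
          ∃ m : ℕ,
            ((copN n γ - algebraMap ℂ (KK n) (evalVZ n v z γ) • 1) ^ m) w ∈ Mv) ↔
        ∃ c : {σ : SgN n // IsShuffle n blk z σ} →₀ ℂ,
          w - (c.sum fun σ a => algebraMap ℂ (KK n) a • symV n blk (PdV σ.1 (T n z)))
            ∈ Mv)) ∧
    -- (iii) dim_ℂ V_z = η!/ε(z)! : the number of shuffles for z times the order of the
    -- stabilizer of z in S_η equals η!
    (∀ z ∈ Nset n blk,
      Nat.card {σ : SgN n // IsShuffle n blk z σ} *
        Nat.card {σ : SgN n // σ ∈ SgEta n blk ∧ permZ0 n σ z = z} =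
      etaFactB n blk) := by
  intro Lη Mv
  have hinj : ∀ y ∈ Nset n blk, ∀ z ∈ Nset n blk,
      (∀ γ : InvPol n, evalVZ n v y γ = evalVZ n v z γ) → y = z := fun y hy z hz h =>
    eq_of_evalVZ_eq hmono hcrit1 hcrit2 hy hz fun γ hγ => h ⟨γ, hγ⟩
  have hM : ∀ γ : InvPol n, ∀ w ∈ piSub PdV πv, copN n γ w ∈ piSub PdV πv := fun γ w hw =>
    copN_mem_piSub hmono hPdV hcrit2 γ.2 hw
  refine ⟨fun γ hγ => ⟨fun w hw => copN_mem_Leta hmono hPdV hcrit2 hγ hw, hM ⟨γ, hγ⟩⟩,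
    fun γ hγ z _ σ hσ => nilN_pow_symV_mem_piSub hmono hPdV hcrit2 hπv hγ z hσ.1
      (Nat.lt_succ_self _),
    eq_zero_of_sum_mem_piSub hmono hPdV hcrit2 hπv,
    fun w hw => exists_sub_sum_mem_piSub hmono hPdV hcrit2 hπv hw,
    fun z hz w hw => ⟨fun h => ?_, fun ⟨c, hc⟩ γ hγ => ?_⟩,
    fun z hz => card_isShuffle_mul_card_stabilizer hmono hz⟩
  · exact exists_sub_sum_mem_piSub_of_mem_wtSpace hmono hPdV hcrit2 hπv hinj hM hz hw
      ((mkQ_mem_wtSpace hM).2 fun γ => h γ.1 γ.2)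
  · exact nilN_pow_mem_piSub_of_sub_sum hmono hPdV hcrit2 hπv hγ c hc

end GTpaper

end
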